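/- Let F be a C₁-field, A a finite-dimensional F-algebra of finite representation type, and K/F a field extension in which F is perfectly closed. Then A_K = K ⊗_F A is also of finite representation type. -/

import Mathlib

open TensorProduct

/-- `F` is a `C₁`-field. -/
def IsC1Field (F : Type) [Field F] : Prop :=
  ∀ (n d : ℕ) (f : MvPolynomial (Fin n) F), f.IsHomogeneous d → 0 < d → d < n →
    ∃ x : Fin n → F, x ≠ 0 ∧ MvPolynomial.eval x f = 0

/-- A module is indecomposable if it is nontrivial and admits no nontrivial
direct sum decomposition. -/
def IsIndecomposableModule (A M : Type) [Ring A] [AddCommGroup M] [Module A M] : Prop :=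
  Nontrivial M ∧ ∀ N P : Submodule A M, IsCompl N P → N = ⊥ ∨ P = ⊥

/-- The ring `A` has finite representation type: there are only finitely many
isomorphism classes of finitely generated indecomposable `A`-modules. -/
def FiniteRepType (A : Type) [Ring A] : Prop :=
  ∃ S : Set (ModuleCat.{0} A), S.Finite ∧
    ∀ M : ModuleCat.{0} A, Module.Finite A M → IsIndecomposableModule A M →
      ∃ N ∈ S, Nonempty (M ≃ₗ[A] N)

/-- `F` is perfectly closed in `K`: every finite subextension of `K/F` is
separable over `F`. -/
def PerfectlyClosedIn (F K : Type) [Field F] [Field K] [Algebra F K] : Prop :=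
  ∀ E : IntermediateField F K, FiniteDimensional F E → Algebra.IsSeparable F E



/-- `P` is in `add Q`. -/
def InAdd (R Q P : Type) [Ring R] [AddCommGroup Q] [AddCommGroup P] [Module R Q] [Module R P] : Prop :=
  ∃ (ι : Type) (_ : Fintype ι) (α : ι → Q →ₗ[R] P) (β : ι → P →ₗ[R] Q), ∑ l, α l ∘ₗ β l = LinearMap.id

section KS
variable {R : Type} [Ring R]

theorem isUnit_or_isNilpotent_of_indec {X : Type} [AddCommGroup X] [Module R X]
    [IsNoetherian R X] [IsArtinian R X] (hX : IsIndecomposableModule R X) (f : Module.End R X) :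
    IsUnit f ∨ IsNilpotent f := by
  obtain ⟨n, hn⟩ := Filter.eventually_atTop.mp f.eventually_isCompl_ker_pow_range_pow
  have h := hn (n + 1) (Nat.le_succ n)
  rcases hX.2 _ _ h with h' | h'
  · left
    have h2 : LinearMap.range (f ^ (n+1)) = ⊤ := by
      have := h.sup_eq_top; rwa [h', bot_sup_eq] at this
    have : IsUnit (f ^ (n+1)) := by
      rw [Module.End.isUnit_iff]
      exact ⟨LinearMap.ker_eq_bot.mp h', LinearMap.range_eq_top.mp h2⟩
    exact (isUnit_pow_iff (Nat.succ_ne_zero n)).mp this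
  · right
    exact ⟨n+1, LinearMap.range_eq_bot.mp h'⟩

theorem exists_isUnit_of_sum {X : Type} [AddCommGroup X] [Module R X]
    [IsNoetherian R X] [IsArtinian R X] (hX : IsIndecomposableModule R X) {ι : Type} (s : Finset ι)
    (f : ι → Module.End R X) (h : IsUnit (∑ i ∈ s, f i)) : ∃ i ∈ s, IsUnit (f i) := by
  classical
  have := hX.1
  have : IsLocalRing (Module.End R X) := by
    refine IsLocalRing.of_isUnit_or_isUnit_one_sub_self fun a => ?_
    rcases isUnit_or_isNilpotent_of_indec hX a with h | h
    · exact Or.inl h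
    · exact Or.inr h.isUnit_one_sub
  induction s using Finset.induction_on with
  | empty => simp at h
  | insert a s ha ih =>
    rw [Finset.sum_insert ha] at h
    rcases IsLocalRing.isUnit_or_isUnit_of_isUnit_add h with h | h
    · exact ⟨a, by simp, h⟩
    · obtain ⟨i, hi, h⟩ := ih h
      exact ⟨i, by simp [hi], h⟩

/-- splitting in an indecomposable is iso -/
theorem equiv_of_isUnit_comp {X Y : Type} [AddCommGroup X] [Module R X] [AddCommGroup Y] [Module R Y]
    [Nontrivial X] (hY : IsIndecomposableModule R Y) (α : Y →ₗ[R] X) (β : X →ₗ[R] Y)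
    (h : IsUnit (α ∘ₗ β : Module.End R X)) : Nonempty (X ≃ₗ[R] Y) := by
  obtain ⟨u, hu⟩ := h
  let α' : Y →ₗ[R] X := (↑u⁻¹ : Module.End R X) ∘ₗ α
  have h1 : α' ∘ₗ β = LinearMap.id := by
    have : (↑u⁻¹ : Module.End R X) * (u : Module.End R X) = 1 := by simp
    rw [hu] at this
    exact this
  have h2 : ∀ x, α' (β x) = x := fun x => LinearMap.congr_fun h1 x
  have hc : IsCompl (LinearMap.ker α') (LinearMap.range β) :=
    (LinearMap.isCompl_of_proj (p := LinearMap.range β) (f := β.rangeRestrict ∘ₗ α') (by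
      rintro ⟨_, x, rfl⟩
      ext
      simp [h2])).symm |> fun h => by
        have hk : LinearMap.ker (β.rangeRestrict ∘ₗ α') = LinearMap.ker α' := by
          apply LinearMap.ker_comp_of_ker_eq_bot
          rw [LinearMap.ker_eq_bot]
          intro a b hab
          have : β a = β b := congrArg Subtype.val hab
          rw [← h2 a, this, h2]
        rwa [hk] at h
  rcases hY.2 _ _ hc with h | h
  · refine ⟨LinearEquiv.ofLinearMap β α' ?_ h1⟩
    ext y
    have : α' (β (α' y)) = α' y := h2 _
    exact LinearMap.ker_eq_bot.mp h this
  · exfalso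
    obtain ⟨x, hx⟩ := exists_ne (0 : X)
    apply hx
    rw [← h2 x, LinearMap.range_eq_bot.mp h]; simp

/-- existence of decompositions -/
theorem exists_decomp (n : ℕ) : ∀ (X : Type) [AddCommGroup X] [Module R X]
    [IsNoetherian R X] [IsArtinian R X], Module.length R X ≤ n →
    ∃ (ι : Type) (_ : Fintype ι) (Y : ι → ModuleCat.{0} R) (σ : ∀ i, Y i →ₗ[R] X) (π : ∀ i, X →ₗ[R] Y i),
      (∀ i, Module.Finite R (Y i) ∧ IsIndecomposableModule R (Y i)) ∧
      ∑ i, σ i ∘ₗ π i = LinearMap.id := by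
  induction n using Nat.strong_induction_on with
  | _ n ih =>
  intro X _ _ _ _ hX
  by_cases hs : Subsingleton X
  · refine ⟨Empty, inferInstance, Empty.elim, fun i => i.elim, fun i => i.elim, fun i => i.elim, ?_⟩
    ext x; exact Subsingleton.elim _ _
  have hnt : Nontrivial X := not_subsingleton_iff_nontrivial.mp hs
  by_cases hI : IsIndecomposableModule R X
  · refine ⟨Unit, inferInstance, fun _ => ModuleCat.of R X, fun _ => LinearMap.id, fun _ => LinearMap.id, fun i => ⟨?_, hI⟩, ?_⟩
    · exact inferInstanceAs (Module.Finite R X)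
    · ext x; simp
  · simp only [IsIndecomposableModule, hnt, true_and, not_forall, not_or] at hI
    obtain ⟨N, P, hc, hN, hP⟩ := hI
    have key : ∀ N P : Submodule R X, IsCompl N P → P ≠ ⊥ → ∃ k < n, Module.length R N ≤ k := by
      intro N P hc hP
      have hlt : N < ⊤ := by
        rw [lt_top_iff_ne_top]; rintro rfl
        exact hP (by simpa using hc.inf_eq_bot)
      have := Submodule.length_lt hlt.ne
      have hlt' : Module.length R N < n := this.trans_le hX
      obtain ⟨k, hk⟩ := ENat.ne_top_iff_exists.mp (ne_top_of_lt hlt')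
      refine ⟨k, ?_, hk.symm.le⟩
      rw [← hk] at hlt'; exact_mod_cast hlt'
    obtain ⟨k, hk, hkN⟩ := key N P hc hP
    obtain ⟨l, hl, hlP⟩ := key P N hc.symm hN
    obtain ⟨ι, _, Y, σ, π, h1, h2⟩ := ih k hk N hkN
    obtain ⟨ι', _, Y', σ', π', h1', h2'⟩ := ih l hl P hlP
    refine ⟨ι ⊕ ι', inferInstance, Sum.elim Y Y',
      fun i => match i with
        | .inl i => N.subtype ∘ₗ σ i
        | .inr i => P.subtype ∘ₗ σ' i,
      fun i => match i with
        | .inl i => π i ∘ₗ N.projectionOnto P hc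
        | .inr i => π' i ∘ₗ P.projectionOnto N hc.symm, ?_, ?_⟩
    · rintro (i | i)
      · exact h1 i
      · exact h1' i
    · ext x
      rw [Fintype.sum_sum_type]
      have e1 := congrArg Subtype.val (LinearMap.congr_fun h2 (N.projectionOnto P hc x))
      have e2 := congrArg Subtype.val (LinearMap.congr_fun h2' (P.projectionOnto N hc.symm x))
      simp only [LinearMap.sum_apply, LinearMap.comp_apply, LinearMap.id_apply,
        AddSubmonoidClass.coe_finsetSum] at e1 e2
      simp only [LinearMap.add_apply, LinearMap.sum_apply, LinearMap.comp_apply, LinearMap.id_apply,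
        Submodule.subtype_apply]
      refine (congrArg₂ (· + ·) e1 e2).trans ?_
      simpa using Submodule.projection_add_projection_eq_self hc x

theorem exists_decomp' (X : Type) [AddCommGroup X] [Module R X]
    [IsNoetherian R X] [IsArtinian R X] :
    ∃ (ι : Type) (_ : Fintype ι) (Y : ι → ModuleCat.{0} R) (σ : ∀ i, Y i →ₗ[R] X) (π : ∀ i, X →ₗ[R] Y i),
      (∀ i, Module.Finite R (Y i) ∧ IsIndecomposableModule R (Y i)) ∧
      ∑ i, σ i ∘ₗ π i = LinearMap.id := by
  obtain ⟨k, hk⟩ := ENat.ne_top_iff_exists.mp (Module.length_ne_top (R := R) (M := X))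
  exact exists_decomp k X hk.symm.le

/-- If every f.g. indecomposable is in `add M`, `M` finite length, then finite rep type. -/
theorem finiteRepType_of_inAdd [IsArtinianRing R] (M : Type) [AddCommGroup M] [Module R M]
    [Module.Finite R M]
    (h : ∀ (X : Type) [AddCommGroup X] [Module R X], Module.Finite R X → InAdd R M X) :
    FiniteRepType R := by
  obtain ⟨ι, _, Y, σ, π, h1, h2⟩ := exists_decomp' (R := R) M
  refine ⟨Set.range Y, Set.finite_range Y, fun X hfin hX => ?_⟩
  obtain ⟨κ, _, α, β, hαβ⟩ := h X hfin
  have : ∑ x : κ × ι, (α x.1 ∘ₗ σ x.2 ∘ₗ π x.2 ∘ₗ β x.1 : Module.End R X) = 1 := by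
    rw [Fintype.sum_prod_type]
    refine Eq.trans ?_ hαβ
    refine Finset.sum_congr rfl fun k _ => ?_
    ext x
    have := LinearMap.congr_fun h2 (β k x)
    simp only [LinearMap.sum_apply, LinearMap.comp_apply, LinearMap.id_apply] at this
    simp only [LinearMap.sum_apply, LinearMap.comp_apply]
    rw [← map_sum, this]
  obtain ⟨⟨k, i⟩, -, hu⟩ := exists_isUnit_of_sum hX Finset.univ _ (by rw [this]; exact isUnit_one)
  have := hX.1
  exact ⟨Y i, ⟨i, rfl⟩, equiv_of_isUnit_comp (h1 i).2 (α k ∘ₗ σ i) (π i ∘ₗ β k) hu⟩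

/-- finite rep type gives an additive generator -/
theorem FiniteRepType.exists_inAdd [IsArtinianRing R] (h : FiniteRepType R) :
    ∃ M : ModuleCat.{0} R, Module.Finite R M ∧
      ∀ (X : Type) [AddCommGroup X] [Module R X], Module.Finite R X → InAdd R M X := by
  classical
  obtain ⟨S, hS, h⟩ := h
  have hS' : {M ∈ S | Module.Finite R M}.Finite := hS.subset (Set.sep_subset _ _)
  obtain ⟨n, f, hf⟩ := hS'.fin_embedding
  have hfin : ∀ i, Module.Finite R (f i) := fun i => by
    have : f i ∈ {M ∈ S | Module.Finite R M} := hf ▸ ⟨i, rfl⟩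
    exact this.2
  refine ⟨ModuleCat.of R (∀ i, f i), inferInstanceAs (Module.Finite R (∀ i, f i)), ?_⟩
  intro X _ _ hX
  obtain ⟨ι, _, Y, σ, π, h1, h2⟩ := exists_decomp' (R := R) X
  have : ∀ i, ∃ j, Nonempty (Y i ≃ₗ[R] f j) := by
    intro i
    obtain ⟨N, hN, ⟨e⟩⟩ := h (Y i) (h1 i).1 (h1 i).2
    have : N ∈ Set.range f := by
      rw [hf]
      have := (h1 i).1
      exact ⟨hN, Module.Finite.equiv e⟩
    obtain ⟨j, rfl⟩ := this
    exact ⟨j, ⟨e⟩⟩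
  choose j e using this
  refine ⟨ι, inferInstance, fun i => σ i ∘ₗ (e i).some.symm.toLinearMap ∘ₗ LinearMap.proj (j i),
    fun i => LinearMap.single R (fun i => f i) (j i) ∘ₗ (e i).some.toLinearMap ∘ₗ π i, ?_⟩
  rw [← h2]
  refine Finset.sum_congr rfl fun i _ => ?_
  ext x
  simp
end KS


section MacLane

theorem exists_root_of_sum_eq_zero {E : Type} [Field E] (p : ℕ) [hp : Fact p.Prime] [CharP E p]
    (a : E) (y : Fin p → E) (hy : y ≠ 0) (h : ∑ j : Fin p, a ^ (j : ℕ) * y j ^ p = 0) :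
    ∃ c, c ^ p = a := by
  classical
  by_contra hc
  push Not at hc
  have hirr : Irreducible (Polynomial.X ^ p - Polynomial.C a) :=
    X_pow_sub_C_irreducible_of_prime hp.out hc
  let g : Polynomial E := ∑ j : Fin p, Polynomial.C (y j) * Polynomial.X ^ (j : ℕ)
  have hg0 : g ≠ 0 := by
    obtain ⟨j, hj⟩ := Function.ne_iff.mp hy
    intro h0
    apply hj
    have := congrArg (fun q => Polynomial.coeff q (j : ℕ)) h0
    simpa [g, Polynomial.finsetSum_coeff, Polynomial.coeff_C_mul, Polynomial.coeff_X_pow,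
      Fin.val_inj] using this
  have hdeg : g.degree < p := by
    refine (Polynomial.degree_sum_le _ _).trans_lt ?_
    rw [Finset.sup_lt_iff (by exact_mod_cast WithBot.bot_lt_coe p)]
    intro j _
    refine (Polynomial.degree_C_mul_X_pow_le _ _).trans_lt ?_
    exact_mod_cast j.2
  have hcop : IsCoprime (Polynomial.X ^ p - Polynomial.C a) g := by
    rw [hirr.coprime_iff_not_dvd]
    intro hd
    have := Polynomial.degree_le_of_dvd hd hg0
    rw [Polynomial.degree_X_pow_sub_C hp.out.pos] at this
    exact absurd hdeg (not_lt.mpr this)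
  obtain ⟨u, v, huv⟩ := hcop
  have := congrArg (Polynomial.eval₂ (frobenius E p) a) huv
  rw [Polynomial.eval₂_add, Polynomial.eval₂_mul, Polynomial.eval₂_mul] at this
  have e1 : Polynomial.eval₂ (frobenius E p) a (Polynomial.X ^ p - Polynomial.C a) = 0 := by
    simp [frobenius_def]
  have e2 : Polynomial.eval₂ (frobenius E p) a g = 0 := by
    rw [← h]
    simp only [g, Polynomial.eval₂_finsetSum]
    refine Finset.sum_congr rfl fun j _ => ?_
    rw [Polynomial.eval₂_mul, Polynomial.eval₂_C, Polynomial.eval₂_X_pow, frobenius_def]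
    exact mul_comm _ _
  rw [e1, e2] at this
  simp at this

theorem c1_expand {F : Type} [Field F] (hC1 : IsC1Field F) (p : ℕ) [hp : Fact p.Prime] [CharP F p]
    (a : F) (ha : ∀ c, c ^ p ≠ a) (b : F) : ∃ y : Fin p → F, b = ∑ j : Fin p, a ^ (j : ℕ) * y j ^ p := by
  let f : MvPolynomial (Fin (p + 1)) F :=
    ∑ j : Fin p, MvPolynomial.C (a ^ (j : ℕ)) * MvPolynomial.X j.castSucc ^ p
      - MvPolynomial.C b * MvPolynomial.X (Fin.last p) ^ p
  have hf : f.IsHomogeneous p := by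
    have hm : ∀ (c : F) (i : Fin (p + 1)),
        (MvPolynomial.C c * MvPolynomial.X i ^ p : MvPolynomial (Fin (p + 1)) F).IsHomogeneous p := by
      intro c i
      have := (MvPolynomial.isHomogeneous_C (Fin (p + 1)) c).mul
        ((MvPolynomial.isHomogeneous_X F i).pow p)
      rwa [one_mul, zero_add] at this
    exact (MvPolynomial.IsHomogeneous.sum _ _ _ fun j _ => hm _ _).sub (hm _ _)
  obtain ⟨x, hx, h0⟩ := hC1 (p + 1) p f hf hp.out.pos (Nat.lt_succ_self p)
  simp only [f, map_sub, map_sum, map_mul, map_pow, MvPolynomial.eval_C, MvPolynomial.eval_X] at h0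
  by_cases hl : x (Fin.last p) = 0
  · exfalso
    rw [hl, zero_pow hp.out.ne_zero, mul_zero, sub_zero] at h0
    obtain ⟨c, hc⟩ := exists_root_of_sum_eq_zero p a (fun j => x j.castSucc) (by
      intro h
      apply hx
      ext i
      refine Fin.lastCases hl (fun j => ?_) i
      exact congrFun h j) h0
    exact ha c hc
  · refine ⟨fun j => x j.castSucc / x (Fin.last p), ?_⟩
    have : ∑ j : Fin p, a ^ (j : ℕ) * (x j.castSucc / x (Fin.last p)) ^ p
      = (∑ j : Fin p, a ^ (j : ℕ) * (x j.castSucc) ^ p) / (x (Fin.last p)) ^ p := by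
      rw [Finset.sum_div]
      refine Finset.sum_congr rfl fun j _ => by rw [div_pow, mul_div_assoc]
    rw [this, sub_eq_zero.mp h0]
    field_simp

theorem macLane {F K : Type} [Field F] [Field K] [Algebra F K] (hC1 : IsC1Field F)
    (p : ℕ) [hp : Fact p.Prime] [CharP F p]
    (h : ∀ (c : K) (a : F), c ^ p = algebraMap F K a → ∃ b : F, b ^ p = a)
    (s : Finset K) (hs : LinearIndepOn F _root_.id (s : Set K)) :
    LinearIndepOn F (· ^ p) (s : Set K) := by
  have : CharP K p := charP_of_injective_algebraMap (algebraMap F K).injective p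
  rw [linearIndepOn_finset_iff] at hs ⊢
  simp only [id] at hs
  intro g hg x hx
  by_cases hperf : ∀ a : F, ∃ b, b ^ p = a
  · choose b hb using hperf
    have h1 : (∑ i ∈ s, b (g i) • i) ^ p = 0 := by
      rw [← frobenius_def, map_sum, ← hg]
      refine Finset.sum_congr rfl fun i _ => ?_
      rw [frobenius_def, smul_pow, hb]
    have h2 := hs (fun i => b (g i)) (pow_eq_zero_iff hp.out.ne_zero |>.mp h1) x hx
    rw [← hb (g x), h2, zero_pow hp.out.ne_zero]
  · push Not at hperf
    obtain ⟨a, ha⟩ := hperf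
    choose b hb using c1_expand hC1 p a ha
    have h1 : ∑ j : Fin p, (algebraMap F K a) ^ (j : ℕ) * (∑ i ∈ s, b (g i) j • i) ^ p = 0 := by
      have : ∀ j, (∑ i ∈ s, b (g i) j • i) ^ p = ∑ i ∈ s, (b (g i) j) ^ p • i ^ p := by
        intro j
        rw [← frobenius_def, map_sum]
        refine Finset.sum_congr rfl fun i _ => ?_
        rw [frobenius_def, smul_pow]
      simp_rw [this, Finset.mul_sum]
      rw [Finset.sum_comm, ← hg]
      refine Finset.sum_congr rfl fun i _ => ?_
      conv_rhs => rw [hb (g i), Finset.sum_smul]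
      refine Finset.sum_congr rfl fun j _ => ?_
      rw [Algebra.smul_def, Algebra.smul_def]; simp only [map_mul, map_pow]; ring
    by_cases hy : (fun j => ∑ i ∈ s, b (g i) j • i) = 0
    · rw [hb (g x)]
      refine Finset.sum_eq_zero fun j _ => ?_
      rw [hs (fun i => b (g i) j) (congrFun hy j) x hx, zero_pow hp.out.ne_zero, mul_zero]
    · obtain ⟨c, hc⟩ := exists_root_of_sum_eq_zero p _ _ hy h1
      obtain ⟨b, hb⟩ := h c a hc
      exact absurd hb (ha b)

theorem pthroot_of_perfectlyClosed {F K : Type} [Field F] [Field K] [Algebra F K]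
    (hpc : PerfectlyClosedIn F K) (p : ℕ) [hp : Fact p.Prime] [CharP F p] (c : K) (a : F)
    (h : c ^ p = algebraMap F K a) : ∃ b : F, b ^ p = a := by
  have hInt : IsIntegral F c := ⟨Polynomial.X ^ p - Polynomial.C a,
    Polynomial.monic_X_pow_sub_C a hp.out.ne_zero, by simp [h]⟩
  have : FiniteDimensional F (IntermediateField.adjoin F {c}) :=
    IntermediateField.adjoin.finiteDimensional hInt
  have hsep := hpc _ this
  have h1 := hsep.isSeparable' (⟨c, IntermediateField.mem_adjoin_simple_self F c⟩ :
    IntermediateField.adjoin F {c})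
  by_contra hb
  push Not at hb
  have hirr : Irreducible (Polynomial.X ^ p - Polynomial.C a) :=
    X_pow_sub_C_irreducible_of_prime hp.out hb
  have hmin := minpoly.eq_of_irreducible_of_monic hirr
    (x := (⟨c, IntermediateField.mem_adjoin_simple_self F c⟩ : IntermediateField.adjoin F {c}))
    (by
      apply Subtype.ext
      simp [h]) (Polynomial.monic_X_pow_sub_C a hp.out.ne_zero)
  rw [IsSeparable, ← hmin, Polynomial.Separable] at h1
  simp only [Polynomial.derivative_sub, Polynomial.derivative_X_pow, Polynomial.derivative_C,
    CharP.cast_eq_zero, map_zero, zero_mul, sub_zero, isCoprime_zero_right] at h1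
  exact hirr.not_isUnit h1
end MacLane


section Semiprime

/-- elementwise semiprimeness -/
def SemiprimeElt (R : Type) [Ring R] : Prop := ∀ x : R, (∀ r, x * r * x = 0) → x = 0

theorem mem_jacobson_of_nil {R : Type} [Ring R] (x : R) (h : ∀ r, IsNilpotent (r * x)) :
    x ∈ Ring.jacobson R := by
  rw [← Ideal.jacobson_bot, Ideal.mem_jacobson_iff]
  intro y
  obtain ⟨u, hu⟩ := (h y).isUnit_one_add
  refine ⟨↑u⁻¹, ?_⟩
  have : (↑u⁻¹ : R) * y * x + ↑u⁻¹ - 1 = ↑u⁻¹ * (1 + y * x) - 1 := by noncomm_ring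
  rw [this, ← hu]
  simp

theorem semiprime_of_semisimple {R : Type} [Ring R] [IsSemisimpleRing R] : SemiprimeElt R := by
  intro x hx
  have : x ∈ Ring.jacobson R := by
    apply mem_jacobson_of_nil
    intro r
    refine ⟨2, ?_⟩
    rw [pow_two, mul_assoc, ← mul_assoc x, hx, mul_zero]
  rw [IsSemisimpleRing.jacobson_eq_bot] at this
  exact this

theorem semisimple_of_semiprime {R : Type} [Ring R] [IsArtinianRing R] (h : SemiprimeElt R) :
    IsSemisimpleRing R := by
  have hn : IsNilpotent (Ring.jacobson R) := IsSemiprimaryRing.isNilpotent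
  have hJ : Ring.jacobson R = ⊥ := by
    obtain ⟨n, hn⟩ := hn
    have hn : Ring.jacobson R ^ (n + 1) = ⊥ := by
      rw [Submodule.pow_succ, hn]; exact Submodule.bot_mul _
    clear * - hn h
    induction n with
    | zero => exact (Submodule.pow_one _).symm.trans hn
    | succ n ih =>
      apply ih
      rw [eq_bot_iff]
      intro x hx
      apply h
      intro r
      have hx' : x ∈ Ring.jacobson R := Ideal.pow_le_self (Nat.succ_ne_zero n) hx
      have := Ideal.mul_mem_mul hx ((Ring.jacobson R).mul_mem_left r hx')
      rw [← Submodule.pow_succ, hn] at this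
      rw [mul_assoc]
      exact this
  exact (IsArtinianRing.isSemisimpleRing_iff_jacobson).mpr hJ

end Semiprime

section Maschke
variable {F E L S : Type} [Field F] [Field E] [Field L] [Algebra F E] [Algebra F L] [Algebra E L]
  [IsScalarTower F E L] [Ring S] [Algebra F S]

theorem semisimple_of_separable [Algebra.IsSeparable E L] [Algebra.EssFiniteType E L]
    (h : IsSemisimpleRing (E ⊗[F] S)) : IsSemisimpleRing (L ⊗[F] S) := by
  let ψ : E ⊗[F] S →ₐ[F] L ⊗[F] S := Algebra.TensorProduct.map (IsScalarTower.toAlgHom F E L) (AlgHom.id F S)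
  let : Module (E ⊗[F] S) (L ⊗[F] S) := Module.compHom _ ψ.toRingHom
  have smul_def : ∀ (r : E ⊗[F] S) (x : L ⊗[F] S), r • x = ψ r * x := fun _ _ => rfl
  have : IsSemisimpleModule (E ⊗[F] S) (L ⊗[F] S) := inferInstance
  rw [IsSemisimpleRing, isSemisimpleModule_iff]
  constructor
  intro N
  let N' : Submodule (E ⊗[F] S) (L ⊗[F] S) :=
    { N with smul_mem' := fun r x hx => N.smul_mem (ψ r) hx }
  obtain ⟨P, hP⟩ := exists_isCompl N'
  let p₀ := N'.projection P hP
  let p : (L ⊗[F] S) →ₗ[E] (L ⊗[F] S) :=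
    { toFun := p₀
      map_add' := map_add p₀
      map_smul' := fun e x => by
        have : ∀ y : L ⊗[F] S, e • y = (e ⊗ₜ[F] (1 : S)) • y := by
          intro y
          rw [smul_def]
          simp only [ψ, Algebra.TensorProduct.map_tmul, map_one]
          induction y with
          | zero => simp
          | add a b ha hb => rw [smul_add, ha, hb, mul_add]
          | tmul a b => simp [TensorProduct.smul_tmul', Algebra.smul_def]
        rw [this, map_smul, ← this]; rfl }
  have hsm : ∀ (a : L) (y : L ⊗[F] S), a • y = (a ⊗ₜ[F] (1 : S)) * y := by
    intro a y
    rw [Algebra.smul_def]; rfl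
  have hpN : ∀ x, p x ∈ N := fun x => Submodule.projection_apply_mem (p := N') hP x
  have hpx : ∀ x ∈ N, p x = x := fun x hx => Submodule.projection_apply_of_mem_left (p := N') hP hx
  have hps : ∀ (s : S) x, p ((1 ⊗ₜ s) * x) = (1 ⊗ₜ s) * p x := by
    intro s x
    have := map_smul p₀ ((1 : E) ⊗ₜ[F] s) x
    simp only [smul_def, ψ, Algebra.TensorProduct.map_tmul, map_one] at this
    exact this
  let Φ : L ⊗[E] L →ₗ[E] ((L ⊗[F] S) →ₗ[E] (L ⊗[F] S)) :=
    TensorProduct.lift (LinearMap.mk₂ E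
      (fun a b => (Algebra.lsmul E E (L ⊗[F] S) a) ∘ₗ p ∘ₗ (Algebra.lsmul E E (L ⊗[F] S) b))
      (by intros; ext; simp) (by intros; ext; simp)
      (by intros; ext; simp) (by intro c a b; ext x; simp [smul_comm a c]))
  have hΦ : ∀ a b x, Φ (a ⊗ₜ b) x = a • p (b • x) := fun _ _ _ => rfl
  have hΦN : ∀ t x, Φ t x ∈ N := by
    intro t x
    induction t with
    | zero => simp
    | add a b ha hb => rw [map_add]; exact N.add_mem ha hb
    | tmul a b =>
      rw [hΦ]
      have := N.smul_mem (a ⊗ₜ[F] (1 : S)) (hpN (b • x))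
      rwa [smul_eq_mul, ← hsm] at this
  have hΦx : ∀ t, ∀ x ∈ N, Φ t x = (Algebra.TensorProduct.lmul' E t : L) • x := by
    intro t x hx
    induction t with
    | zero => simp
    | add a b ha hb => rw [map_add, map_add, add_smul, LinearMap.add_apply, ha, hb]
    | tmul a b =>
      rw [hΦ]
      have := N.smul_mem (b ⊗ₜ[F] (1 : S)) hx
      rw [smul_eq_mul, ← hsm] at this
      rw [hpx _ this, Algebra.TensorProduct.lmul'_apply_tmul, mul_smul]
  have hΦs : ∀ t (s : S) x, Φ t ((1 ⊗ₜ s) * x) = (1 ⊗ₜ s) * Φ t x := by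
    intro t s x
    induction t with
    | zero => simp
    | add a b ha hb => rw [map_add, LinearMap.add_apply, LinearMap.add_apply, ha, hb, mul_add]
    | tmul a b =>
      rw [hΦ, hΦ, ← mul_smul_comm, hps, mul_smul_comm]
  have hΦl : ∀ t (l : L) x, Φ (l ⊗ₜ 1 * t) x = l • Φ t x := by
    intro t l x
    induction t with
    | zero => simp
    | add a b ha hb => rw [mul_add, map_add, map_add, LinearMap.add_apply, LinearMap.add_apply, ha, hb, smul_add]
    | tmul a b => rw [Algebra.TensorProduct.tmul_mul_tmul, one_mul, hΦ, hΦ, mul_smul]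
  have hΦr : ∀ t (l : L) x, Φ (1 ⊗ₜ l * t) x = Φ t (l • x) := by
    intro t l x
    induction t with
    | zero => simp
    | add a b ha hb => rw [mul_add, map_add, map_add, LinearMap.add_apply, LinearMap.add_apply, ha, hb]
    | tmul a b => rw [Algebra.TensorProduct.tmul_mul_tmul, one_mul, hΦ, hΦ, ← mul_smul, mul_comm b]
  have : Algebra.FormallyUnramified E L := Algebra.FormallyUnramified.of_isSeparable E L
  let t := Algebra.FormallyUnramified.elem E L
  let q : (L ⊗[F] S) →ₗ[L ⊗[F] S] N :=
    { toFun := fun x => ⟨Φ t x, hΦN t x⟩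
      map_add' := fun x y => by ext; simp
      map_smul' := fun r x => by
        apply Subtype.ext
        simp only [RingHom.id_apply, SetLike.mk_smul_mk, smul_eq_mul]
        induction r with
        | zero => simp
        | add a b ha hb => rw [add_mul, map_add, ha, hb, add_mul]
        | tmul l s =>
          have : (l ⊗ₜ[F] s) = l • ((1 : L) ⊗ₜ[F] s) := by simp [TensorProduct.smul_tmul']
          rw [this, smul_mul_assoc, smul_mul_assoc, ← hΦs, ← hΦl, ← hΦr,
            Algebra.FormallyUnramified.one_tmul_mul_elem] }
  refine ⟨_, LinearMap.isCompl_of_proj (f := q) ?_⟩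
  rintro ⟨x, hx⟩
  apply Subtype.ext
  change Φ t x = x
  rw [hΦx t x hx]
  have : Algebra.TensorProduct.lmul' E t = 1 := Algebra.FormallyUnramified.lmul_elem
  rw [this, one_smul]
end Maschke


section PolySemiprime
variable {F E S : Type} [Field F] [Field E] [Algebra F E] [Ring S] [Algebra F S]

theorem semiprime_mvPolynomial (n : ℕ) (hS : SemiprimeElt S) :
    SemiprimeElt (MvPolynomial (Fin n) F ⊗[F] S) := by
  classical
  let c := TensorProduct.equivFinsuppOfBasisLeft (N := S) (MvPolynomial.basisMonomials (Fin n) F)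
  have hc : ∀ p s m, c (p ⊗ₜ s) m = MvPolynomial.coeff m p • s := fun p s m =>
    TensorProduct.equivFinsuppOfBasisLeft_apply_tmul_apply _ _ _ _
  have key : ∀ (y z : MvPolynomial (Fin n) F ⊗[F] S) (s : S) m,
      c (y * (1 ⊗ₜ s) * z) m = ∑ x ∈ Finset.HasAntidiagonal.antidiagonal m, c y x.1 * s * c z x.2 := by
    intro y z s m
    induction y with
    | zero => simp
    | add a b ha hb =>
      simp only [add_mul, map_add, Finsupp.add_apply, ha, hb, Finset.sum_add_distrib]
    | tmul p t =>
      induction z with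
      | zero => simp
      | add a b ha hb =>
        simp only [mul_add, map_add, Finsupp.add_apply, ha, hb, Finset.sum_add_distrib]
      | tmul q u =>
        rw [Algebra.TensorProduct.tmul_mul_tmul, Algebra.TensorProduct.tmul_mul_tmul, hc,
          mul_one, MvPolynomial.coeff_mul, Finset.sum_smul]
        refine Finset.sum_congr rfl fun x _ => ?_
        rw [hc, hc, smul_mul_assoc, smul_mul_assoc, mul_smul_comm, mul_smul]
  intro y hy
  by_contra hne
  have hne' : (c y).support.Nonempty := by
    rw [Finsupp.support_nonempty_iff]
    simpa using hne
  obtain ⟨m, hm, hmax⟩ := Finset.exists_max_image (c y).support (fun a => toLex a) hne'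
  rw [Finsupp.mem_support_iff] at hm
  apply hm
  apply hS
  intro s
  have h1 := key y y s (m + m)
  rw [hy, map_zero, Finset.sum_eq_single (m, m)] at h1
  · exact h1.symm
  · rintro ⟨a, b⟩ hab hne
    rw [Finset.HasAntidiagonal.mem_antidiagonal] at hab
    by_contra h0
    have ha : a ∈ (c y).support := by
      rw [Finsupp.mem_support_iff]
      intro h; apply h0; simp [h]
    have hb : b ∈ (c y).support := by
      rw [Finsupp.mem_support_iff]
      intro h; apply h0; simp [h]
    have ha := hmax a ha
    have hb := hmax b hb
    have hab' : toLex a + toLex b = toLex m + toLex m := congrArg toLex hab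
    have : toLex a = toLex m := by
      rcases ha.lt_or_eq with h | h
      · exact absurd hab' (add_lt_add_of_lt_of_le h hb).ne
      · exact h
    have hb2 : toLex b = toLex m := by rw [this] at hab'; exact add_left_cancel hab'
    exact hne (Prod.ext (toLex.injective this) (toLex.injective hb2))
  · intro h; exact absurd (by simp) h

theorem semiprime_fractions (n : ℕ) (hS : SemiprimeElt S) (φ : MvPolynomial (Fin n) F →ₐ[F] E)
    (hφ : Function.Injective φ) (hfr : ∀ e, ∃ a b, φ b ≠ 0 ∧ e * φ b = φ a) :
    SemiprimeElt (E ⊗[F] S) := by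
  let ψ : MvPolynomial (Fin n) F ⊗[F] S →ₐ[F] E ⊗[F] S := Algebra.TensorProduct.map φ (AlgHom.id F S)
  have hψ : Function.Injective ψ :=
    Module.Flat.rTensor_preserves_injective_linearMap (M := S) φ.toLinearMap hφ
  have clear : ∀ x : E ⊗[F] S, ∃ b y, φ b ≠ 0 ∧ (φ b ⊗ₜ 1) * x = ψ y := by
    intro x
    induction x with
    | zero => exact ⟨1, 0, by simp, by simp⟩
    | tmul e s =>
      obtain ⟨a, b, hb, h⟩ := hfr e
      exact ⟨b, a ⊗ₜ s, hb, by simp [ψ, ← h, mul_comm]⟩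
    | add u v hu hv =>
      obtain ⟨b, y, hb, h⟩ := hu
      obtain ⟨b', y', hb', h'⟩ := hv
      refine ⟨b * b', (b' ⊗ₜ 1) * y + (b ⊗ₜ 1) * y', by simp [hb, hb'], ?_⟩
      rw [map_add, map_mul φ, map_mul ψ (b' ⊗ₜ 1), map_mul ψ (b ⊗ₜ 1), ← h, ← h', mul_add, ← mul_assoc, ← mul_assoc]
      simp [ψ, mul_comm]
  intro x hx
  obtain ⟨b, y, hb, h⟩ := clear x
  have hcomm : ∀ z : E ⊗[F] S, (φ b ⊗ₜ 1) * z = z * (φ b ⊗ₜ 1) := by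
    intro z
    induction z with
    | zero => simp
    | tmul e s => simp [mul_comm]
    | add u v hu hv => rw [mul_add, hu, hv, add_mul]
  have hy : y = 0 := by
    apply semiprime_mvPolynomial n hS
    intro r
    apply hψ
    have e : (φ b ⊗ₜ[F] (1 : S) * x) * ψ r * (φ b ⊗ₜ[F] (1 : S) * x)
      = φ b ⊗ₜ[F] (1 : S) * (x * (ψ r * φ b ⊗ₜ[F] (1 : S)) * x) := by simp only [mul_assoc]
    rw [map_mul, map_mul, ← h, map_zero, e, hx, mul_zero]
  have : ((φ b)⁻¹ ⊗ₜ[F] (1 : S)) * ((φ b ⊗ₜ 1) * x) = x := by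
    rw [← mul_assoc, Algebra.TensorProduct.tmul_mul_tmul, inv_mul_cancel₀ hb, one_mul,
      ← Algebra.TensorProduct.one_def, one_mul]
  rw [← this, h, hy, map_zero, mul_zero]
end PolySemiprime

section SemisimpleBC
variable {F K S : Type} [Field F] [Field K] [Algebra F K] [Ring S] [Algebra F S]

theorem semisimple_of_separably_generated [FiniteDimensional F S] [IsSemisimpleRing S]
    [Algebra.EssFiniteType F K]
    (h : ∃ s : Finset K, IsTranscendenceBasis F ((↑) : s → K) ∧
      Algebra.IsSeparable (IntermediateField.adjoin F (s : Set K)) K) :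
    IsSemisimpleRing (K ⊗[F] S) := by
  obtain ⟨s, hs, hsep⟩ := h
  let E := IntermediateField.adjoin F (s : Set K)
  have : Algebra.EssFiniteType E K := Algebra.EssFiniteType.of_comp F E K
  have : IsArtinianRing (E ⊗[F] S) := IsArtinianRing.of_finite E (E ⊗[F] S)
  apply semisimple_of_separable (E := E)
  apply semisimple_of_semiprime
  let e := s.equivFin
  let i : Fin s.card → K := fun j => (e.symm j : K)
  have hi : AlgebraicIndependent F i := hs.1.comp _ e.symm.injective
  have hr : Set.range i = s := by
    ext x
    constructor
    · rintro ⟨j, rfl⟩; exact (e.symm j).2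
    · intro hx; exact ⟨e ⟨x, hx⟩, by simp [i]⟩
  let iE : Fin s.card → E := fun j => ⟨i j, IntermediateField.subset_adjoin F _ (e.symm j).2⟩
  have hval : ∀ p : MvPolynomial (Fin s.card) F, ((MvPolynomial.aeval iE p : E) : K) = MvPolynomial.aeval i p := by
    intro p
    have := MvPolynomial.aeval_algebraMap_apply (A := E) K iE p
    exact this.symm
  refine semiprime_fractions s.card semiprime_of_semisimple (MvPolynomial.aeval iE) ?_ ?_
  · intro p q hpq
    apply hi
    change MvPolynomial.aeval i p = MvPolynomial.aeval i q
    rw [← hval, ← hval, hpq]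
  · rintro ⟨x, hx⟩
    have hx2 : x ∈ IntermediateField.adjoin F (s : Set K) := hx
    rw [← hr, IntermediateField.mem_adjoin_range_iff] at hx2
    obtain ⟨r, t, hrt⟩ := hx2
    by_cases ht : MvPolynomial.aeval i t = 0
    · refine ⟨0, 1, by simp, ?_⟩
      apply Subtype.ext
      rw [ht, div_zero] at hrt
      simp [hrt]
    · refine ⟨r, t, ?_, ?_⟩
      · intro h; apply ht; rw [← hval, h]; rfl
      · apply Subtype.ext
        rw [MulMemClass.coe_mul, hval, hval]
        change x * _ = _
        rw [hrt, div_mul_cancel₀ _ ht]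

theorem semisimple_baseChange [FiniteDimensional F S] [IsSemisimpleRing S]
    (hC1 : IsC1Field F) (hpc : PerfectlyClosedIn F K) : IsSemisimpleRing (K ⊗[F] S) := by
  classical
  have : IsArtinianRing (K ⊗[F] S) := IsArtinianRing.of_finite K (K ⊗[F] S)
  apply semisimple_of_semiprime
  intro x hx
  obtain ⟨T, hT⟩ := TensorProduct.exists_finset x
  let T' : Finset K := T.image Prod.fst
  let E := IntermediateField.adjoin F (T' : Set K)
  have hfg : Algebra.EssFiniteType F E := by
    rw [IntermediateField.essFiniteType_iff]
    exact ⟨T', rfl⟩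
  have hE : IsSemisimpleRing (E ⊗[F] S) := by
    apply semisimple_of_separably_generated
    rcases CharP.exists' F with h0 | ⟨p, hp, hpF⟩
    · exact exists_isTranscendenceBasis_and_isSeparable_of_perfectField F E
    · have : ExpChar F p := ExpChar.prime hp.out
      apply exists_isTranscendenceBasis_and_isSeparable_of_linearIndepOn_pow_of_essFiniteType
        p hp.out
      intro s hs
      apply macLane hC1 p _ s hs
      intro c a hca
      exact pthroot_of_perfectlyClosed hpc p (c : K) a (by
        have := congrArg (algebraMap E K) hca
        rw [map_pow] at this
        exact this)
  let ψ : E ⊗[F] S →ₐ[F] K ⊗[F] S := Algebra.TensorProduct.map E.val (AlgHom.id F S)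
  have hψ : Function.Injective ψ :=
    Module.Flat.rTensor_preserves_injective_linearMap (M := S) E.val.toLinearMap
      Subtype.val_injective
  have hxr : x ∈ ψ.range := by
    rw [hT]
    refine sum_mem fun i hi => ?_
    refine ⟨⟨i.1, IntermediateField.subset_adjoin F _ (Finset.mem_coe.mpr
      (Finset.mem_image_of_mem _ hi))⟩ ⊗ₜ i.2, ?_⟩
    simp [ψ]
  obtain ⟨y, hy⟩ := hxr
  have : y = 0 := by
    apply semiprime_of_semisimple (R := E ⊗[F] S)
    intro r
    apply hψ
    have hy' : ψ y = x := hy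
    rw [map_mul, map_mul, hy', hx, map_zero]
  rw [← hy, this]
  exact map_zero ψ
end SemisimpleBC


section ProjDim
open CategoryTheory

variable {R : Type} [Ring R]

/-- projective dimension `< n` for unbundled modules -/
def PdLT (R M : Type) [Ring R] [AddCommGroup M] [Module R M] (n : ℕ) : Prop :=
  HasProjectiveDimensionLT (ModuleCat.of R M) n

variable {X Y Z : Type} [AddCommGroup X] [Module R X] [AddCommGroup Y] [Module R Y]
  [AddCommGroup Z] [Module R Z]

theorem pdLT_one_iff : PdLT R X 1 ↔ Module.Projective R X := by
  rw [PdLT, ← projective_iff_hasProjectiveDimensionLT_one, IsProjective.iff_projective]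

theorem PdLT.of_subsingleton [Subsingleton X] (n : ℕ) : PdLT R X n := by
  have : HasProjectiveDimensionLT (ModuleCat.of R X) 0 :=
    Limits.IsZero.hasProjectiveDimensionLT_zero (ModuleCat.isZero_of_subsingleton _)
  exact hasProjectiveDimensionLT_of_ge _ 0 n (Nat.zero_le _)

theorem PdLT.mono {m n : ℕ} (h : PdLT R X m) (hmn : m ≤ n) : PdLT R X n := by
  have : HasProjectiveDimensionLT (ModuleCat.of R X) m := h
  exact hasProjectiveDimensionLT_of_ge _ m n hmn

theorem PdLT.retract {n : ℕ} (h : PdLT R Y n) (i : X →ₗ[R] Y) (r : Y →ₗ[R] X)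
    (hri : r ∘ₗ i = LinearMap.id) : PdLT R X n := by
  have : HasProjectiveDimensionLT (ModuleCat.of R Y) n := h
  exact Retract.hasProjectiveDimensionLT (Y := ModuleCat.of R Y)
    ⟨ModuleCat.ofHom i, ModuleCat.ofHom r, by rw [← ModuleCat.ofHom_comp, hri]; rfl⟩ n

theorem PdLT.equiv {n : ℕ} (h : PdLT R Y n) (e : X ≃ₗ[R] Y) : PdLT R X n :=
  h.retract e.toLinearMap e.symm.toLinearMap (by ext; simp)

variable {f : X →ₗ[R] Y} {g : Y →ₗ[R] Z}

theorem shortExact_aux (hf : Function.Injective f) (hfg : Function.Exact f g)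
    (hg : Function.Surjective g) :
    (ShortComplex.mk (ModuleCat.ofHom f) (ModuleCat.ofHom g) (by
      rw [← ModuleCat.ofHom_comp, hfg.linearMap_comp_eq_zero]; rfl)).ShortExact :=
  ModuleCat.shortComplex_shortExact _ hfg hf hg

theorem PdLT.ext {n : ℕ} (hf : Function.Injective f) (hfg : Function.Exact f g)
    (hg : Function.Surjective g) (h₁ : PdLT R X n) (h₃ : PdLT R Z n) : PdLT R Y n :=
  (shortExact_aux hf hfg hg).hasProjectiveDimensionLT_X₂ n h₁ h₃

theorem PdLT.quot {n : ℕ} (hf : Function.Injective f) (hfg : Function.Exact f g)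
    (hg : Function.Surjective g) (h₁ : PdLT R X n) (h₂ : PdLT R Y (n + 1)) : PdLT R Z (n + 1) :=
  (shortExact_aux hf hfg hg).hasProjectiveDimensionLT_X₃ n h₁ h₂

theorem PdLT.sub {n : ℕ} (hf : Function.Injective f) (hfg : Function.Exact f g)
    (hg : Function.Surjective g) (h₂ : PdLT R Y n) (h₃ : PdLT R Z (n + 1)) : PdLT R X n :=
  (shortExact_aux hf hfg hg).hasProjectiveDimensionLT_X₁ n h₂ h₃

theorem exact_subtype_mkQ (N : Submodule R X) : Function.Exact N.subtype N.mkQ := by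
  rw [LinearMap.exact_iff]; simp

theorem pdLT_three_of_semisimple [IsArtinianRing R] (q : R →ₗ[R] Y) (hq : Function.Surjective q)
    (hker : LinearMap.ker q ≤ Ring.jacobson R) (hss : IsSemisimpleModule R Y) (hpd : PdLT R Y 3) :
    Module.Finite R X → PdLT R X 3 := by
  intro hX
  have simple : ∀ (T : Type) [AddCommGroup T] [Module R T], IsSimpleModule R T → PdLT R T 3 := by
    intro T _ _ hT
    obtain ⟨m, hm, ⟨e⟩⟩ := isSimpleModule_iff_quot_maximal.mp hT
    refine PdLT.equiv ?_ e
    have hle : LinearMap.ker q ≤ LinearMap.ker m.mkQ := by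
      rw [Submodule.ker_mkQ]
      refine hker.trans ?_
      rw [← Ideal.jacobson_bot]
      exact sInf_le ⟨bot_le, hm⟩
    let eY : Y ≃ₗ[R] R ⧸ LinearMap.ker q := (q.quotKerEquivOfSurjective hq).symm
    let s : Y →ₗ[R] R ⧸ m := (LinearMap.ker q).liftQ m.mkQ hle ∘ₗ eY.toLinearMap
    have hs : Function.Surjective s := by
      rintro x
      obtain ⟨r, rfl⟩ := m.mkQ_surjective x
      exact ⟨eY.symm ((LinearMap.ker q).mkQ r), by simp [s]⟩
    obtain ⟨i, hi⟩ := IsSemisimpleModule.lifting_property s hs LinearMap.id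
    exact hpd.retract i s hi
  have : IsFiniteLength R X := isFiniteLength_iff_isNoetherian_isArtinian.mpr
    ⟨inferInstance, inferInstance⟩
  clear hX
  induction this with
  | of_subsingleton => exact PdLT.of_subsingleton 3
  | @of_simple_quotient M _ _ N hs _ ih =>
    exact PdLT.ext N.injective_subtype (exact_subtype_mkQ N) N.mkQ_surjective ih (simple _ hs)

theorem ker_projective_of_pdLT {X Y : Type} [AddCommGroup X] [Module R X] [AddCommGroup Y]
    [Module R Y] (f : X →ₗ[R] Y) [Module.Projective R X] [Module.Projective R Y]
    (h : PdLT R (Y ⧸ LinearMap.range f) 3) : Module.Projective R (LinearMap.ker f) := by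
  have h1 : PdLT R (LinearMap.range f) 2 :=
    PdLT.sub (LinearMap.range f).injective_subtype (exact_subtype_mkQ _)
      (LinearMap.range f).mkQ_surjective ((pdLT_one_iff.mpr inferInstance).mono (by norm_num)) h
  rw [← pdLT_one_iff]
  refine PdLT.sub (f := (LinearMap.ker f).subtype) (g := f.rangeRestrict)
    (LinearMap.ker f).injective_subtype ?_ f.surjective_rangeRestrict
    (pdLT_one_iff.mpr inferInstance) h1
  rw [LinearMap.exact_iff]; simp
end ProjDim


section BaseChange
variable (F K : Type) [Field F] [Field K] [Algebra F K]

/-- base change of a vector space, as a type synonym carrying module structures over `K ⊗ R`. -/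
def BC (M : Type) [AddCommGroup M] [Module F M] : Type := K ⊗[F] M

section
variable (M : Type) [AddCommGroup M] [Module F M]
noncomputable instance : AddCommGroup (BC F K M) := inferInstanceAs (AddCommGroup (K ⊗[F] M))
noncomputable instance : Module K (BC F K M) := inferInstanceAs (Module K (K ⊗[F] M))
end

variable {M N P : Type} [AddCommGroup M] [Module F M] [AddCommGroup N] [Module F N]
  [AddCommGroup P] [Module F P]

/-- pure tensors -/
def bt (k : K) (m : M) : BC F K M := k ⊗ₜ[F] m

variable {K} in
theorem BC.induction {p : BC F K M → Prop} (x : BC F K M) (h0 : p 0) (ht : ∀ k m, p (bt F K k m))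
    (ha : ∀ x y, p x → p y → p (x + y)) : p x :=
  TensorProduct.induction_on x h0 ht ha

theorem bt_add (k : K) (m m' : M) : bt F K k (m + m') = bt F K k m + bt F K k m' :=
  TensorProduct.tmul_add _ _ _
theorem add_bt (k k' : K) (m : M) : bt F K (k + k') m = bt F K k m + bt F K k' m :=
  TensorProduct.add_tmul _ _ _
theorem bt_sum {ι : Type} (s : Finset ι) (k : K) (m : ι → M) :
    bt F K k (∑ i ∈ s, m i) = ∑ i ∈ s, bt F K k (m i) :=
  TensorProduct.tmul_sum _ _ _
theorem bt_smul (c : F) (k : K) (m : M) : bt F K k (c • m) = bt F K (c • k) m :=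
  (TensorProduct.smul_tmul c k m).symm
theorem bt_zero (k : K) : bt F K k (0 : M) = 0 := TensorProduct.tmul_zero _ _

section act
variable (R : Type) [Ring R] [Algebra F R] [Module R M] [IsScalarTower F R M]
  [Module R N] [IsScalarTower F R N] [Module R P] [IsScalarTower F R P]

/-- the action of `K ⊗ R` on `K ⊗ M` -/
noncomputable def bcAct : K ⊗[F] R →ₐ[K] Module.End K (K ⊗[F] M) :=
  Algebra.TensorProduct.lift (Algebra.ofId K _)
    ((Module.End.baseChangeHom F K M).comp (Algebra.lsmul F F M))
    (fun x _ => Algebra.commutes x _)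

noncomputable instance : Module (K ⊗[F] R) (BC F K M) :=
  Module.compHom (K ⊗[F] M) (bcAct F K (M := M) R).toRingHom

theorem bc_smul (k l : K) (r : R) (m : M) :
    (k ⊗ₜ[F] r : K ⊗[F] R) • bt F K l m = bt F K (k * l) (r • m) := by
  change bcAct F K (M := M) R (k ⊗ₜ r) (l ⊗ₜ m) = (k * l) ⊗ₜ (r • m)
  have h := Algebra.TensorProduct.lift_tmul (Algebra.ofId K (Module.End K (K ⊗[F] M)))
    ((Module.End.baseChangeHom F K M).comp (Algebra.lsmul F F M))
    (fun x _ => Algebra.commutes x _) k r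
  refine (LinearMap.congr_fun h (l ⊗ₜ[F] m)).trans ?_
  change k • (l ⊗ₜ[F] (r • m)) = (k * l) ⊗ₜ[F] (r • m)
  rw [TensorProduct.smul_tmul', smul_eq_mul]

variable {F K R} in
/-- an additive map is `K ⊗ R`-linear if it is so on pure tensors -/
def bcMk {X : Type} [AddCommGroup X] [Module (K ⊗[F] R) X] (g : BC F K M →+ X)
    (h : ∀ k r l m, g (bt F K (k * l) (r • m)) = (k ⊗ₜ[F] r : K ⊗[F] R) • g (bt F K l m)) :
    BC F K M →ₗ[K ⊗[F] R] X :=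
  { g with
    map_smul' := fun r x => by
      change g (r • x) = r • g x
      induction r with
      | zero => rw [zero_smul, zero_smul, map_zero]
      | add a b ha hb => rw [add_smul, add_smul, map_add, ha, hb]
      | tmul k r =>
        induction x using BC.induction with
        | h0 => rw [smul_zero, map_zero, smul_zero]
        | ha x y hx hy => rw [smul_add, map_add, map_add, smul_add, hx, hy]
        | ht l m => rw [bc_smul, h] }

/-- functoriality -/
noncomputable def bcMap (f : M →ₗ[R] N) : BC F K M →ₗ[K ⊗[F] R] BC F K N :=
  bcMk ((LinearMap.lTensor K (f.restrictScalars F)).toAddMonoidHom : K ⊗[F] M →+ K ⊗[F] N)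
    (fun k r l m => by
      change bt F K (k * l) (f (r • m)) = (k ⊗ₜ[F] r : K ⊗[F] R) • bt F K l (f m)
      rw [bc_smul, map_smul])

@[simp] theorem bcMap_bt (f : M →ₗ[R] N) (k : K) (m : M) :
    bcMap F K R f (bt F K k m) = bt F K k (f m) := rfl

variable {F K R} in
theorem bc_ext_add {X : Type} [AddCommGroup X] {f g : BC F K M →+ X}
    (h : ∀ k m, f (bt F K k m) = g (bt F K k m)) : f = g := by
  ext x
  induction x using BC.induction with
  | h0 => simp
  | ht k m => exact h k m
  | ha x y hx hy => rw [map_add, map_add, hx, hy]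

variable {F K R} in
theorem bc_ext {X S : Type} [Ring S] [AddCommGroup X] [Module S X] [Module S (BC F K M)]
    {f g : BC F K M →ₗ[S] X}
    (h : ∀ k m, f (bt F K k m) = g (bt F K k m)) : f = g := by
  ext x
  exact DFunLike.congr_fun (bc_ext_add (f := f.toAddMonoidHom) (g := g.toAddMonoidHom) h) x

theorem bcMap_id : bcMap F K R (LinearMap.id : M →ₗ[R] M) = LinearMap.id := bc_ext fun _ _ => rfl

theorem bcMap_comp (g : N →ₗ[R] P) (f : M →ₗ[R] N) :
    bcMap F K R (g ∘ₗ f) = bcMap F K R g ∘ₗ bcMap F K R f := bc_ext fun _ _ => rfl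

theorem bcMap_sum {ι : Type} (s : Finset ι) (f : ι → M →ₗ[R] N) :
    bcMap F K R (∑ i ∈ s, f i) = ∑ i ∈ s, bcMap F K R (f i) := bc_ext fun k m => by
  simp [LinearMap.sum_apply, bt_sum]

theorem InAdd.bc (h : InAdd R M N) : InAdd (K ⊗[F] R) (BC F K M) (BC F K N) := by
  obtain ⟨ι, _, α, β, h⟩ := h
  refine ⟨ι, inferInstance, fun i => bcMap F K R (α i), fun i => bcMap F K R (β i), ?_⟩
  simp only [← bcMap_comp]
  rw [← bcMap_sum, h, bcMap_id]

theorem bcMap_injective (f : M →ₗ[R] N) (hf : Function.Injective f) :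
    Function.Injective (bcMap F K R f) :=
  Module.Flat.lTensor_preserves_injective_linearMap (M := K) (f.restrictScalars F) hf

theorem bcMap_surjective (f : M →ₗ[R] N) (hf : Function.Surjective f) :
    Function.Surjective (bcMap F K R f) :=
  LinearMap.lTensor_surjective (g := f.restrictScalars F) K hf

theorem bcMap_exact (f : M →ₗ[R] N) (g : N →ₗ[R] P) (h : Function.Exact f g) :
    Function.Exact (bcMap F K R f) (bcMap F K R g) :=
  Module.Flat.lTensor_exact (M := K) (f := f.restrictScalars F) (g := g.restrictScalars F) h

/-- `K ⊗ R` as a module over itself -/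
noncomputable def bcSelf : BC F K R ≃ₗ[K ⊗[F] R] K ⊗[F] R :=
  LinearEquiv.ofBijective (bcMk (AddMonoidHom.id (K ⊗[F] R)) (fun k r l m => by
      change (k * l) ⊗ₜ[F] (r * m) = (k ⊗ₜ[F] r) * (l ⊗ₜ[F] m)
      rw [Algebra.TensorProduct.tmul_mul_tmul]))
    Function.bijective_id

theorem bcSelf_bt (k : K) (r : R) : bcSelf F K R (bt F K k r) = k ⊗ₜ r := rfl
end act

end BaseChange


section InAddBasics
variable {R P Q S : Type} [Ring R] [AddCommGroup P] [Module R P] [AddCommGroup Q] [Module R Q]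
  [AddCommGroup S] [Module R S]

theorem InAdd.of_retract (i : P →ₗ[R] Q) (r : Q →ₗ[R] P) (h : r ∘ₗ i = LinearMap.id) :
    InAdd R Q P := ⟨Unit, inferInstance, fun _ => r, fun _ => i, by simpa using h⟩

theorem InAdd.trans (h : InAdd R Q P) (h' : InAdd R P S) : InAdd R Q S := by
  obtain ⟨ι, _, α, β, h⟩ := h
  obtain ⟨κ, _, γ, δ, h'⟩ := h'
  refine ⟨κ × ι, inferInstance, fun x => γ x.1 ∘ₗ α x.2, fun x => β x.2 ∘ₗ δ x.1, ?_⟩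
  rw [← h', Fintype.sum_prod_type]
  refine Finset.sum_congr rfl fun k _ => ?_
  ext x
  have := LinearMap.congr_fun h (δ k x)
  simp only [LinearMap.sum_apply, LinearMap.comp_apply, LinearMap.id_apply] at this ⊢
  rw [← map_sum, this]

theorem InAdd.of_equiv (e : P ≃ₗ[R] Q) : InAdd R Q P :=
  InAdd.of_retract e.toLinearMap e.symm.toLinearMap (by ext; simp)

theorem InAdd.pi (ι : Type) [Fintype ι] [DecidableEq ι] : InAdd R Q (ι → Q) :=
  ⟨ι, inferInstance, fun i => LinearMap.single R (fun _ => Q) i, fun i => LinearMap.proj i, by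
    ext i x j
    simp only [LinearMap.sum_apply, LinearMap.comp_apply, LinearMap.id_apply, LinearMap.proj_apply,
      Finset.sum_apply, LinearMap.single_apply]
    rw [Finset.sum_eq_single j]
    · simp
    · intro b _ hb; simp [Pi.single_apply, hb.symm]
    · simp⟩

/-- a module in `add Q` is a retract of a finite power of `Q` -/
theorem InAdd.exists_retract (h : InAdd R Q P) : ∃ (ι : Type) (_ : Fintype ι) (_ : DecidableEq ι)
    (i : P →ₗ[R] (ι → Q)) (r : (ι → Q) →ₗ[R] P), r ∘ₗ i = LinearMap.id := by
  classical
  obtain ⟨ι, _, α, β, h⟩ := h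
  refine ⟨ι, inferInstance, inferInstance, LinearMap.pi β,
    ∑ l, α l ∘ₗ LinearMap.proj l, ?_⟩
  rw [← h]
  ext x
  simp [LinearMap.sum_apply]

theorem InAdd.projective [Module.Projective R Q] (h : InAdd R Q P) : Module.Projective R P := by
  obtain ⟨ι, _, _, i, r, h⟩ := h.exists_retract
  have : Module.Projective R (ι → Q) := Module.Projective.of_equiv (DFinsupp.linearEquivFunOnFintype (R := R) (M := fun _ : ι => Q))
  exact Module.Projective.of_split i r h

theorem InAdd.finite [Module.Finite R Q] (h : InAdd R Q P) : Module.Finite R P := by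
  obtain ⟨ι, _, _, i, r, h⟩ := h.exists_retract
  exact Module.Finite.of_surjective r (fun x => ⟨i x, LinearMap.congr_fun h x⟩)

theorem InAdd.of_projective [Module.Finite R P] [Module.Projective R P] : InAdd R R P := by
  obtain ⟨n, f, hf⟩ := Module.Finite.exists_fin' R P
  obtain ⟨g, hg⟩ := Module.projective_lifting_property f LinearMap.id hf
  exact (InAdd.pi (Fin n)).trans (InAdd.of_retract g f hg)
end InAddBasics

section Auslander

/-- over the endomorphism ring of an additive generator, kernels of maps between free modules are
in `add B`. -/
theorem inAdd_ker {A N : Type} [Ring A] [AddCommGroup N] [Module A N] [Module.Finite A N]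
    (hN : ∀ (X : Type) [AddCommGroup X] [Module A X], Module.Finite A X → InAdd A N X)
    (m : ℕ) (g : (Fin m → Module.End A N) →ₗ[Module.End A N] Module.End A N) :
    InAdd (Module.End A N) (Module.End A N) (LinearMap.ker g) := by
  let d : Fin m → Module.End A N := fun l => g (fun j => if l = j then 1 else 0)
  have hg : ∀ b, g b = ∑ l, b l * d l := fun b => LinearMap.pi_apply_eq_sum_univ g b
  let D : N →ₗ[A] (Fin m → N) := LinearMap.pi d
  obtain ⟨ι, _, α, β, h⟩ := hN ((Fin m → N) ⧸ LinearMap.range D) inferInstance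
  -- the map on the quotient
  let bar : LinearMap.ker g → ((Fin m → N) ⧸ LinearMap.range D) →ₗ[A] N := fun z =>
    (LinearMap.range D).liftQ (∑ l, (z : Fin m → Module.End A N) l ∘ₗ LinearMap.proj l) (by
      rintro _ ⟨n, rfl⟩
      have := LinearMap.congr_fun ((hg z).symm.trans z.2) n
      simpa [D, LinearMap.sum_apply] using this)
  have bar_mk : ∀ z x, bar z ((LinearMap.range D).mkQ x)
      = ∑ l, (z : Fin m → Module.End A N) l (x l) := by
    intro z x
    simp [bar, LinearMap.sum_apply]
  have bar_ext : ∀ (z : LinearMap.ker g) (f : ((Fin m → N) ⧸ LinearMap.range D) →ₗ[A] N),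
      (∀ x, ∑ l, (z : Fin m → Module.End A N) l (x l) = f ((LinearMap.range D).mkQ x)) →
      bar z = f := by
    intro z f hf
    refine LinearMap.ext fun y => ?_
    obtain ⟨x, rfl⟩ := (LinearMap.range D).mkQ_surjective y
    exact (bar_mk z x).trans (hf x)
  let mk := (LinearMap.range D).mkQ
  let unbar : (((Fin m → N) ⧸ LinearMap.range D) →ₗ[A] N) → LinearMap.ker g := fun f =>
    ⟨fun l => f ∘ₗ mk ∘ₗ LinearMap.single A (fun _ => N) l, by
      rw [LinearMap.mem_ker, hg]
      ext n
      simp only [LinearMap.sum_apply, Module.End.mul_apply, LinearMap.comp_apply,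
        LinearMap.zero_apply]
      rw [← map_sum, ← map_sum]
      have : ∑ l, LinearMap.single A (fun _ => N) l (d l n) = D n := by
        exact LinearMap.sum_single_apply (φ := fun _ => N) (D n)
      rw [this]
      have : mk (D n) = 0 := (Submodule.Quotient.mk_eq_zero _).mpr ⟨n, rfl⟩
      rw [this, map_zero]⟩
  have unbar_bar : ∀ z, unbar (bar z) = z := by
    intro z
    apply Subtype.ext
    funext l
    ext n
    change bar z ((LinearMap.range D).mkQ _) = _
    rw [bar_mk, Finset.sum_eq_single l]
    · simp
    · intro b _ hb; simp [Pi.single_apply, hb]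
    · simp
  have bar_add : ∀ z w, bar (z + w) = bar z + bar w := by
    intro z w
    apply bar_ext
    intro x
    rw [LinearMap.add_apply, bar_mk, bar_mk, ← Finset.sum_add_distrib]
    rfl
  have bar_smul : ∀ (b : Module.End A N) z, bar (b • z) = b ∘ₗ bar z := by
    intro b z
    apply bar_ext
    intro x
    rw [LinearMap.comp_apply, bar_mk, map_sum]
    rfl
  refine ⟨ι, inferInstance,
    fun i => { toFun := fun b => unbar (b ∘ₗ β i), map_add' := fun _ _ => rfl, map_smul' := fun _ _ => rfl },
    fun i => { toFun := fun z => bar z ∘ₗ α i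
               map_add' := fun z w => by rw [bar_add]; rfl
               map_smul' := fun b z => by rw [bar_smul]; rfl }, ?_⟩
  ext1 z
  simp only [LinearMap.sum_apply, LinearMap.comp_apply, LinearMap.id_apply, LinearMap.coe_mk,
    AddHom.coe_mk]
  have unbar_sum : ∀ f : ι → ((Fin m → N) ⧸ LinearMap.range D) →ₗ[A] N,
      ∑ i, unbar (f i) = unbar (∑ i, f i) := by
    intro f
    exact (map_sum (AddMonoidHom.mk' unbar (fun _ _ => rfl)) f Finset.univ).symm
  rw [unbar_sum]
  conv_rhs => rw [← unbar_bar z]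
  congr 1
  refine LinearMap.ext fun y => ?_
  obtain ⟨x, rfl⟩ := (LinearMap.range D).mkQ_surjective y
  have := congrArg (bar z) (LinearMap.congr_fun h ((LinearMap.range D).mkQ x))
  simp only [LinearMap.sum_apply, LinearMap.comp_apply, LinearMap.id_apply, map_sum] at this ⊢
  exact this

/-- an additive generator is projective over its endomorphism ring. -/
theorem inAdd_self {A N : Type} [Ring A] [AddCommGroup N] [Module A N]
    (hN : InAdd A N A) : InAdd (Module.End A N) (Module.End A N) N := by
  obtain ⟨ι, _, α, β, h⟩ := hN
  refine ⟨ι, inferInstance,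
    fun i => LinearMap.toSpanSingleton (Module.End A N) N (β i 1),
    fun i => { toFun := fun n => LinearMap.toSpanSingleton A N n ∘ₗ α i
               map_add' := fun x y => by ext; simp
               map_smul' := fun b x => by ext; simp }, ?_⟩
  ext n
  have := LinearMap.congr_fun h 1
  simp only [LinearMap.sum_apply, LinearMap.comp_apply, LinearMap.id_apply] at this
  simp only [LinearMap.sum_apply, LinearMap.comp_apply, LinearMap.id_apply, LinearMap.coe_mk,
    AddHom.coe_mk, LinearMap.toSpanSingleton_apply, Module.End.smul_def]
  rw [← Finset.sum_smul, this, one_smul]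
end Auslander


section GlDim
variable (F K : Type) [Field F] [Field K] [Algebra F K]
  (B : Type) [Ring B] [Algebra F B]

theorem bc_inAdd_projective {Z : Type} [AddCommGroup Z] [Module F Z] [Module B Z]
    [IsScalarTower F B Z] (h : InAdd B B Z) : Module.Projective (K ⊗[F] B) (BC F K Z) := by
  have : Module.Projective (K ⊗[F] B) (BC F K B) := Module.Projective.of_equiv (bcSelf F K B).symm
  exact (InAdd.bc F K B h).projective

theorem bc_inAdd_finite {Z : Type} [AddCommGroup Z] [Module F Z] [Module B Z]
    [IsScalarTower F B Z] (h : InAdd B B Z) : Module.Finite (K ⊗[F] B) (BC F K Z) := by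
  have : Module.Finite (K ⊗[F] B) (BC F K B) := Module.Finite.equiv (bcSelf F K B).symm
  exact (InAdd.bc F K B h).finite

theorem bc_pd_quot [IsNoetherianRing B] (J : Submodule B B)
    (hker : ∀ (m : ℕ) (g : (Fin m → B) →ₗ[B] B), InAdd B B (LinearMap.ker g)) :
    PdLT (K ⊗[F] B) (BC F K (B ⧸ J)) 3 := by
  obtain ⟨m, f, hf⟩ := Module.Finite.exists_fin' B J
  have hk : InAdd B B (LinearMap.ker f) := by
    have := hker m (J.subtype ∘ₗ f)
    rwa [LinearMap.ker_comp, Submodule.ker_subtype, ← LinearMap.ker] at this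
  have p1 := bc_inAdd_projective F K B hk
  have p2 := bc_inAdd_projective F K B (InAdd.pi (R := B) (Q := B) (Fin m))
  have p3 : Module.Projective (K ⊗[F] B) (BC F K B) :=
    Module.Projective.of_equiv (bcSelf F K B).symm
  have h2 : PdLT (K ⊗[F] B) (BC F K J) 2 := by
    refine PdLT.quot (f := bcMap F K B (LinearMap.ker f).subtype) (g := bcMap F K B f)
      (bcMap_injective F K B _ (LinearMap.ker f).injective_subtype)
      (bcMap_exact F K B _ _ ?_) (bcMap_surjective F K B _ hf) (pdLT_one_iff.mpr p1)
      ((pdLT_one_iff.mpr p2).mono (by norm_num))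
    rw [LinearMap.exact_iff]; simp
  exact PdLT.quot (f := bcMap F K B J.subtype) (g := bcMap F K B J.mkQ)
      (bcMap_injective F K B _ J.injective_subtype)
      (bcMap_exact F K B _ _ (exact_subtype_mkQ J)) (bcMap_surjective F K B _ J.mkQ_surjective) h2
      ((pdLT_one_iff.mpr p3).mono (by norm_num))

theorem bc_nilpotent (J : Ideal B) (n : ℕ) (hJ : J ^ n = ⊥) (y : BC F K J) :
    IsNilpotent (bcSelf F K B (bcMap F K B J.subtype y)) := by
  let L : ℕ → AddSubmonoid (K ⊗[F] B) := fun n =>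
    AddSubmonoid.closure {x | ∃ k, ∃ b ∈ J ^ n, x = k ⊗ₜ b}
  set x := bcSelf F K B (bcMap F K B J.subtype y) with hx
  have h1 : x ∈ AddSubmonoid.closure {x : K ⊗[F] B | ∃ k, ∃ b ∈ J, x = k ⊗ₜ b} := by
    rw [hx]
    clear hx
    clear x
    induction y using BC.induction with
    | h0 => rw [map_zero, map_zero]; exact zero_mem _
    | ha a b ha hb => rw [map_add, map_add]; exact add_mem ha hb
    | ht k m => exact AddSubmonoid.subset_closure ⟨k, m, m.2, rfl⟩
  clear_value x
  clear hx
  have hmul : ∀ n, ∀ z ∈ L n, z * x ∈ L (n + 1) := by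
    intro n z hz
    induction hz using AddSubmonoid.closure_induction with
    | zero => rw [zero_mul]; exact zero_mem _
    | add a b _ _ ha hb => rw [add_mul]; exact add_mem ha hb
    | mem z hz =>
      obtain ⟨k, b, hb, rfl⟩ := hz
      induction h1 using AddSubmonoid.closure_induction with
      | zero => rw [mul_zero]; exact zero_mem _
      | add a b _ _ ha hb => rw [mul_add]; exact add_mem ha hb
      | mem w hw =>
        obtain ⟨l, c, hc, rfl⟩ := hw
        rw [Algebra.TensorProduct.tmul_mul_tmul]
        refine AddSubmonoid.subset_closure ⟨k * l, b * c, ?_, rfl⟩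
        rw [Submodule.pow_succ]
        exact Ideal.mul_mem_mul hb hc
  have hpow : ∀ n, x ^ (n + 1) ∈ L (n + 1) := by
    intro n
    induction n with
    | zero =>
      have : L 1 = AddSubmonoid.closure {x : K ⊗[F] B | ∃ k, ∃ b ∈ J, x = k ⊗ₜ b} := by
        simp only [L, Submodule.pow_one]
      rw [zero_add, pow_one, this]
      exact h1
    | succ n ih => rw [pow_succ]; exact hmul _ _ ih
  have hJ' : J ^ (n + 1) = ⊥ := by
    rw [Submodule.pow_succ, hJ]; exact Submodule.bot_mul _
  refine ⟨n + 1, ?_⟩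
  have := hpow n
  simp only [L, hJ'] at this
  have hle : AddSubmonoid.closure {x : K ⊗[F] B | ∃ k, ∃ b ∈ (⊥ : Ideal B), x = k ⊗ₜ b} ≤ ⊥ := by
    rw [AddSubmonoid.closure_le]
    rintro _ ⟨k, b, hb, rfl⟩
    rw [(Submodule.mem_bot B).mp hb, TensorProduct.tmul_zero]
    rfl
  exact hle this

theorem bc_semisimple (J : Ideal B) [J.IsTwoSided] (h : IsSemisimpleRing (K ⊗[F] (B ⧸ J))) :
    IsSemisimpleModule (K ⊗[F] B) (BC F K (B ⧸ J)) := by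
  let ρ : K ⊗[F] B →ₐ[F] K ⊗[F] (B ⧸ J) :=
    Algebra.TensorProduct.map (AlgHom.id F K) (Ideal.Quotient.mkₐ F J)
  have hρ : Function.Surjective ρ :=
    LinearMap.lTensor_surjective (g := (Ideal.Quotient.mkₐ F J).toLinearMap) K
      (Ideal.Quotient.mkₐ_surjective F J)
  have : RingHomSurjective ρ.toRingHom := ⟨hρ⟩
  let e := bcSelf F K (B ⧸ J)
  have he : ∀ (r : K ⊗[F] B) (x : BC F K (B ⧸ J)), e (r • x) = ρ r * e x := by
    intro r x
    induction r with
    | zero => rw [zero_smul, map_zero, map_zero, zero_mul]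
    | add a b ha hb => rw [add_smul, map_add, map_add, ha, hb, add_mul]
    | tmul k b =>
      induction x using BC.induction with
      | h0 => rw [smul_zero, map_zero, mul_zero]
      | ha x y hx hy => rw [smul_add, map_add, map_add, hx, hy, mul_add]
      | ht l m =>
        obtain ⟨c, rfl⟩ := Ideal.Quotient.mk_surjective m
        rw [bc_smul]
        change (k * l) ⊗ₜ[F] (Ideal.Quotient.mk J (b * c)) =
          (k ⊗ₜ[F] Ideal.Quotient.mk J b) * (l ⊗ₜ[F] Ideal.Quotient.mk J c)
        rw [Algebra.TensorProduct.tmul_mul_tmul, map_mul]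
  let l : BC F K (B ⧸ J) →ₛₗ[ρ.toRingHom] K ⊗[F] (B ⧸ J) :=
    { toFun := e, map_add' := map_add e, map_smul' := he }
  exact (l.isSemisimpleModule_iff_of_bijective e.bijective).mpr h

theorem bc_glDim [FiniteDimensional F B] [IsArtinianRing B]
    (hker : ∀ (m : ℕ) (g : (Fin m → B) →ₗ[B] B), InAdd B B (LinearMap.ker g))
    (h : IsSemisimpleRing (K ⊗[F] (B ⧸ Ring.jacobson B)))
    (X : Type) [AddCommGroup X] [Module (K ⊗[F] B) X] (hX : Module.Finite (K ⊗[F] B) X) :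
    PdLT (K ⊗[F] B) X 3 := by
  have : IsArtinianRing (K ⊗[F] B) := IsArtinianRing.of_finite K (K ⊗[F] B)
  let J := Ring.jacobson B
  obtain ⟨n, hn⟩ : IsNilpotent J := IsSemiprimaryRing.isNilpotent
  let q : K ⊗[F] B →ₗ[K ⊗[F] B] BC F K (B ⧸ J) :=
    bcMap F K B J.mkQ ∘ₗ (bcSelf F K B).symm.toLinearMap
  refine pdLT_three_of_semisimple q ?_ ?_ (bc_semisimple F K B J h) (bc_pd_quot F K B J hker) hX
  · exact (bcMap_surjective F K B _ J.mkQ_surjective).comp (bcSelf F K B).symm.surjective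
  · intro x hx
    apply mem_jacobson_of_nil
    intro r
    have hrx : q (r * x) = 0 := (LinearMap.ker q).smul_mem r hx
    obtain ⟨y, hy⟩ := (bcMap_exact F K B _ _ (exact_subtype_mkQ J) _).mp hrx
    have := bc_nilpotent F K B J n hn y
    rw [hy] at this
    simpa using this
end GlDim


section Cogenerator
variable (F : Type) [Field F]

/-- the `F`-linear dual of an algebra, as a left module -/
def DualAlg (A : Type) [Ring A] [Algebra F A] : Type := A →ₗ[F] F

variable (A : Type) [Ring A] [Algebra F A]

noncomputable instance : AddCommGroup (DualAlg F A) := inferInstanceAs (AddCommGroup (A →ₗ[F] F))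
noncomputable instance : Module F (DualAlg F A) := inferInstanceAs (Module F (A →ₗ[F] F))
instance [FiniteDimensional F A] : FiniteDimensional F (DualAlg F A) :=
  inferInstanceAs (FiniteDimensional F (A →ₗ[F] F))

variable {F A} in
/-- evaluation -/
def DualAlg.ev (φ : DualAlg F A) : A →ₗ[F] F := φ

variable {F A} in
theorem DualAlg.ext {φ ψ : DualAlg F A} (h : ∀ s, φ.ev s = ψ.ev s) : φ = ψ := LinearMap.ext h

noncomputable instance : Module A (DualAlg F A) where
  smul a φ := φ.ev ∘ₗ LinearMap.mulRight F a
  one_smul φ := DualAlg.ext fun s => congrArg φ.ev (mul_one s)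
  mul_smul a b φ := DualAlg.ext fun s => congrArg φ.ev (mul_assoc s a b).symm
  smul_zero a := rfl
  smul_add a φ ψ := rfl
  add_smul a b φ := DualAlg.ext fun s => (congrArg φ.ev (mul_add s a b)).trans (map_add φ.ev _ _)
  zero_smul φ := DualAlg.ext fun s => (congrArg φ.ev (mul_zero s)).trans (map_zero φ.ev)

theorem DualAlg.smul_ev (a : A) (φ : DualAlg F A) (s : A) : (a • φ).ev s = φ.ev (s * a) := rfl

instance : IsScalarTower F A (DualAlg F A) where
  smul_assoc c a φ := DualAlg.ext fun s => by
    change φ.ev (s * (c • a)) = c • φ.ev (s * a)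
    rw [mul_smul_comm, map_smul]

variable (K : Type) [Field K] [Algebra F K]

theorem exists_to_dual [FiniteDimensional F A] (X : Type) [AddCommGroup X] [Module (K ⊗[F] A) X]
    (x : X) (hx : x ≠ 0) : ∃ f : X →ₗ[K ⊗[F] A] BC F K (DualAlg F A), f x ≠ 0 := by
  obtain ⟨lam, hlam, hlx⟩ : ∃ lam : X →+ K,
      (∀ k y, lam ((k ⊗ₜ[F] (1 : A) : K ⊗[F] A) • y) = k * lam y) ∧ lam x ≠ 0 := by
    letI : Module K X := Module.compHom X (algebraMap K (K ⊗[F] A))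
    obtain ⟨f, hf⟩ : ∃ f : Module.Dual K X, f x ≠ 0 := by
      by_contra! h
      exact hx ((Module.forall_dual_apply_eq_zero_iff K x).mp h)
    exact ⟨f.toAddMonoidHom, fun k y => map_smul f k y, hf⟩
  let b := Module.finBasis F A
  let bd : Fin (Module.finrank F A) → DualAlg F A := fun i => b.coord i
  have hbd : ∀ i a, (bd i).ev a = b.repr a i := fun _ _ => rfl
  let g : X →+ BC F K (DualAlg F A) :=
    { toFun := fun y => ∑ i, bt F K (lam (((1 : K) ⊗ₜ[F] b i : K ⊗[F] A) • y)) (bd i)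
      map_zero' := by
        refine Finset.sum_eq_zero fun i _ => ?_
        rw [smul_zero, map_zero]; exact TensorProduct.zero_tmul _ _
      map_add' := fun y z => by
        rw [← Finset.sum_add_distrib]
        refine Finset.sum_congr rfl fun i _ => ?_
        rw [smul_add, map_add, add_bt] }
  have hg : ∀ y, g y = ∑ i, bt F K (lam (((1 : K) ⊗ₜ[F] b i : K ⊗[F] A) • y)) (bd i) :=
    fun _ => rfl
  have hlamF : ∀ (c : F) (a : A) (y : X), lam (((1 : K) ⊗ₜ[F] (c • a) : K ⊗[F] A) • y)
      = c • lam (((1 : K) ⊗ₜ[F] a : K ⊗[F] A) • y) := by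
    intro c a y
    have : ((1 : K) ⊗ₜ[F] (c • a) : K ⊗[F] A)
        = ((algebraMap F K c) ⊗ₜ[F] (1 : A)) * ((1 : K) ⊗ₜ[F] a) := by
      rw [Algebra.TensorProduct.tmul_mul_tmul, mul_one, one_mul, ← TensorProduct.smul_tmul,
        Algebra.algebraMap_eq_smul_one]
    rw [this, mul_smul, hlam, Algebra.smul_def]
  have hlamsum : ∀ (a : A) (y : X), lam (((1 : K) ⊗ₜ[F] a : K ⊗[F] A) • y)
      = ∑ j, b.repr a j • lam (((1 : K) ⊗ₜ[F] b j : K ⊗[F] A) • y) := by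
    intro a y
    conv_lhs => rw [← b.sum_repr a, TensorProduct.tmul_sum, Finset.sum_smul, map_sum]
    exact Finset.sum_congr rfl fun j _ => hlamF _ _ _
  have hgA : ∀ (k : K) (a : A) y, g ((k ⊗ₜ[F] a : K ⊗[F] A) • y) = (k ⊗ₜ[F] a : K ⊗[F] A) • g y := by
    intro k a y
    rw [hg, hg, Finset.smul_sum]
    have h1 : ∀ i, lam (((1 : K) ⊗ₜ[F] b i : K ⊗[F] A) • (k ⊗ₜ[F] a : K ⊗[F] A) • y)
        = ∑ j, b.repr (b i * a) j • (k * lam (((1 : K) ⊗ₜ[F] b j : K ⊗[F] A) • y)) := by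
      intro i
      have : ((1 : K) ⊗ₜ[F] b i : K ⊗[F] A) * (k ⊗ₜ[F] a : K ⊗[F] A)
          = (k ⊗ₜ[F] (1 : A)) * ((1 : K) ⊗ₜ[F] (b i * a)) := by
        simp
      rw [← mul_smul, this, mul_smul, hlam, hlamsum, Finset.mul_sum]
      exact Finset.sum_congr rfl fun j _ => mul_smul_comm _ _ _
    have h2 : ∀ j, a • bd j = ∑ i, b.repr (b i * a) j • bd i := by
      intro j
      apply LinearMap.ext
      intro s
      have e1 : (a • bd j).ev s = b.repr (s * a) j := rfl
      refine e1.trans ?_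
      have e2 : ∀ t : Fin (Module.finrank F A) → F, (∑ i, t i • (b.coord i : A →ₗ[F] F)) s
          = ∑ i, t i * b.repr s i := by
        intro t; simp [LinearMap.sum_apply]
      refine Eq.trans ?_ (e2 _).symm
      conv_lhs => rw [← b.sum_repr s, Finset.sum_mul, map_sum, Finset.sum_apply']
      refine Finset.sum_congr rfl fun i _ => ?_
      rw [smul_mul_assoc, map_smul, Finsupp.smul_apply, smul_eq_mul, mul_comm]
    have h3 : ∀ {ι : Type} (s : Finset ι) (k : ι → K) (m : DualAlg F A),
        bt F K (∑ i ∈ s, k i) m = ∑ i ∈ s, bt F K (k i) m := fun s k m => TensorProduct.sum_tmul _ _ _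
    simp only [h1, h3, bc_smul, h2, bt_sum, bt_smul]
    exact Finset.sum_comm
  let f : X →ₗ[K ⊗[F] A] BC F K (DualAlg F A) :=
    { g with
      map_smul' := fun r y => by
        change g (r • y) = r • g y
        induction r with
        | zero => rw [zero_smul, zero_smul, map_zero]
        | add a b ha hb => rw [add_smul, add_smul, map_add, ha, hb]
        | tmul k a => exact hgA k a y }
  refine ⟨f, fun h0 => hlx ?_⟩
  let E : BC F K (DualAlg F A) →+ K := (TensorProduct.lift (LinearMap.mk₂ F
    (fun (k : K) (φ : DualAlg F A) => φ.ev 1 • k) (fun _ _ _ => smul_add _ _ _)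
    (fun _ _ _ => smul_comm _ _ _) (fun _ _ _ => add_smul _ _ _)
    (fun _ _ _ => mul_smul _ _ _))).toAddMonoidHom
  have hE : ∀ k φ, E (bt F K k φ) = φ.ev 1 • k := fun _ _ => rfl
  have h1 : E (g x) = 0 := by
    have : g x = 0 := h0
    rw [this, map_zero]
  rw [hg, map_sum] at h1
  have h2 := hlamsum 1 x
  rw [← Algebra.TensorProduct.one_def, one_smul] at h2
  rw [h2, ← h1]
  refine Finset.sum_congr rfl fun i _ => ?_
  rw [hE, hbd]
end Cogenerator


section Recover
variable {Λ Γ W : Type} [Ring Λ] [Ring Γ] [AddCommGroup W] [Module Λ W] [Module Γ W]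
  [SMulCommClass Λ Γ W]

/-- precomposition -/
def preComp (Γ : Type) [Ring Γ] [Module Γ W] [SMulCommClass Λ Γ W] {X Y : Type} [AddCommGroup X]
    [Module Λ X] [AddCommGroup Y] [Module Λ Y]
    (p : X →ₗ[Λ] Y) : (Y →ₗ[Λ] W) →ₗ[Γ] (X →ₗ[Λ] W) where
  toFun f := f ∘ₗ p
  map_add' _ _ := rfl
  map_smul' _ _ := rfl

theorem hom_free_inAdd (n : ℕ) : InAdd Γ W ((Fin n → Λ) →ₗ[Λ] W) :=
  (InAdd.pi (Fin n)).trans (InAdd.of_equiv ((Pi.basisFun Λ (Fin n)).constr (M' := W) Γ).symm)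

theorem hom_proj [IsNoetherianRing Λ] [IsNoetherianRing Γ] [Module.Finite Γ W]
    [Module.Projective Γ W]
    (hgl : ∀ (Z : Type) [AddCommGroup Z] [Module Γ Z], Module.Finite Γ Z → PdLT Γ Z 3)
    (X : Type) [AddCommGroup X] [Module Λ X] [Module.Finite Λ X] :
    InAdd Γ Γ (X →ₗ[Λ] W) := by
  obtain ⟨n, p, hp⟩ := Module.Finite.exists_fin' Λ X
  obtain ⟨m, s, hs⟩ := Module.Finite.exists_fin' Λ (LinearMap.ker p)
  have := (hom_free_inAdd (Λ := Λ) (Γ := Γ) (W := W) n).projective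
  have := (hom_free_inAdd (Λ := Λ) (Γ := Γ) (W := W) m).projective
  have := (hom_free_inAdd (Λ := Λ) (Γ := Γ) (W := W) n).finite
  have := (hom_free_inAdd (Λ := Λ) (Γ := Γ) (W := W) m).finite
  let Φ : ((Fin n → Λ) →ₗ[Λ] W) →ₗ[Γ] ((Fin m → Λ) →ₗ[Λ] W) :=
    preComp Γ ((LinearMap.ker p).subtype ∘ₗ s)
  have hk : Module.Projective Γ (LinearMap.ker Φ) :=
    ker_projective_of_pdLT Φ (hgl _ inferInstance)
  have hinj : Function.Injective (preComp Γ p : (X →ₗ[Λ] W) →ₗ[Γ] _) := by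
    intro f g h
    ext x
    obtain ⟨y, rfl⟩ := hp x
    exact LinearMap.congr_fun h y
  have hr : LinearMap.range (preComp Γ p : (X →ₗ[Λ] W) →ₗ[Γ] _) = LinearMap.ker Φ := by
    ext f
    rw [LinearMap.mem_ker, LinearMap.mem_range]
    constructor
    · rintro ⟨g, rfl⟩
      apply LinearMap.ext
      intro z
      change g (p (s _)) = 0
      rw [(s _).2, map_zero]
    · intro h
      have hle : LinearMap.ker p ≤ LinearMap.ker f := by
        intro y hy
        obtain ⟨z, hz⟩ := hs ⟨y, hy⟩
        have := LinearMap.congr_fun h z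
        change f (s z) = 0 at this
        rw [hz] at this
        exact this
      refine ⟨(LinearMap.ker p).liftQ f hle ∘ₗ
        (LinearMap.quotKerEquivOfSurjective p hp).symm.toLinearMap, ?_⟩
      apply LinearMap.ext
      intro y
      change (LinearMap.ker p).liftQ f hle ((LinearMap.quotKerEquivOfSurjective p hp).symm (p y)) = f y
      have : (LinearMap.quotKerEquivOfSurjective p hp).symm (p y) = (LinearMap.ker p).mkQ y := by
        rw [LinearEquiv.symm_apply_eq]; rfl
      rw [this]
      rfl
  let e : (X →ₗ[Λ] W) ≃ₗ[Γ] LinearMap.ker Φ :=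
    (LinearEquiv.ofInjective _ hinj).trans (LinearEquiv.ofEq _ _ hr)
  have : Module.Finite Γ (X →ₗ[Λ] W) := Module.Finite.equiv e.symm
  have : Module.Projective Γ (X →ₗ[Λ] W) := Module.Projective.of_equiv e.symm
  exact InAdd.of_projective

theorem recover [Module.Finite Λ W]
    (hfull : ∀ φ : W →ₗ[Λ] W, ∃ b : Γ, ∀ n, φ n = b • n)
    (hcog : ∀ (X : Type) [AddCommGroup X] [Module Λ X], Module.Finite Λ X → ∀ x : X, x ≠ 0 →
      ∃ f : X →ₗ[Λ] W, f x ≠ 0)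
    (X : Type) [AddCommGroup X] [Module Λ X] [Module.Finite Λ X]
    (h : InAdd Γ Γ (X →ₗ[Λ] W)) : InAdd Λ W X := by
  classical
  obtain ⟨ι, _, α, β, h⟩ := h
  let f : ι → X →ₗ[Λ] W := fun l => α l 1
  have hf : ∀ g : X →ₗ[Λ] W, g = ∑ l, β l g • f l := by
    intro g
    have := LinearMap.congr_fun h g
    simp only [LinearMap.sum_apply, LinearMap.comp_apply, LinearMap.id_apply] at this
    conv_lhs => rw [← this]
    refine Finset.sum_congr rfl fun l _ => ?_
    rw [← map_smul, smul_eq_mul, mul_one]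
  have hfx : ∀ (g : X →ₗ[Λ] W) (x : X), g x = ∑ l, β l g • f l x := by
    intro g x
    have := LinearMap.congr_fun (hf g) x
    rw [LinearMap.sum_apply] at this
    exact this
  let j : X →ₗ[Λ] (ι → W) := LinearMap.pi f
  have hj : LinearMap.ker j = ⊥ := by
    rw [LinearMap.ker_eq_bot']
    intro x hx
    by_contra hne
    obtain ⟨g, hg⟩ := hcog X inferInstance x hne
    apply hg
    rw [hfx g x]
    refine Finset.sum_eq_zero fun l _ => ?_
    have : f l x = 0 := congrFun hx l
    rw [this, smul_zero]
  let v : ι → W →ₗ[Λ] (ι → W) := fun l => LinearMap.pi fun k =>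
    { toFun := fun n => β l (f k) • n
      map_add' := fun _ _ => smul_add _ _ _
      map_smul' := fun a n => (smul_comm a (β l (f k)) n).symm }
  have hv : ∀ l n k, v l n k = β l (f k) • n := fun _ _ _ => rfl
  have hmem : ∀ l n, v l n ∈ LinearMap.range j := by
    intro l n
    by_contra hne
    have hq : (LinearMap.range j).mkQ (v l n) ≠ 0 := by
      rw [Submodule.mkQ_apply, Ne, Submodule.Quotient.mk_eq_zero]; exact hne
    obtain ⟨g, hg⟩ := hcog ((ι → W) ⧸ LinearMap.range j) inferInstance _ hq
    choose d hd using fun k => hfull (g ∘ₗ (LinearMap.range j).mkQ ∘ₗ LinearMap.single Λ (fun _ => W) k)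
    have hgd : ∀ y : ι → W, g ((LinearMap.range j).mkQ y) = ∑ k, d k • y k := by
      intro y
      have hy : y = ∑ k, LinearMap.single Λ (fun _ => W) k (y k) := by
        ext k; simp [LinearMap.single_apply, Finset.sum_apply]
      conv_lhs => rw [hy]
      rw [map_sum, map_sum]
      exact Finset.sum_congr rfl fun k _ => hd k (y k)
    have hz : ∑ k, d k • f k = 0 := by
      ext x
      rw [LinearMap.sum_apply]
      have h1 := hgd (j x)
      have h2 : (LinearMap.range j).mkQ (j x) = 0 := by
        rw [Submodule.mkQ_apply, Submodule.Quotient.mk_eq_zero]; exact ⟨x, rfl⟩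
      rw [h2, map_zero] at h1
      exact h1.symm
    apply hg
    rw [hgd]
    have := congrArg (β l) hz
    rw [map_sum, map_zero] at this
    have h3 : (∑ k, β l (d k • f k)) • n = 0 := by rw [this, zero_smul]
    rw [Finset.sum_smul] at h3
    rw [← h3]
    refine Finset.sum_congr rfl fun k _ => ?_
    rw [hv, map_smul, smul_eq_mul, mul_smul]
  let e := LinearEquiv.ofInjective j (LinearMap.ker_eq_bot.mp hj)
  let g : ι → W →ₗ[Λ] X := fun l => e.symm.toLinearMap ∘ₗ (v l).codRestrict _ (hmem l)
  have hg : ∀ l n, j (g l n) = v l n := by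
    intro l n
    have := e.apply_symm_apply ((v l).codRestrict _ (hmem l) n)
    exact congrArg Subtype.val this
  refine ⟨ι, inferInstance, g, f, ?_⟩
  ext x
  apply LinearMap.ker_eq_bot.mp hj
  rw [LinearMap.sum_apply, map_sum]
  ext k
  rw [Finset.sum_apply]
  change _ = f k x
  rw [hfx (f k) x]
  refine Finset.sum_congr rfl fun l _ => ?_
  rw [LinearMap.comp_apply, hg, hv]
end Recover


section Final
variable (F K A : Type) [Field F] [Field K] [Algebra F K] [Ring A] [Algebra F A]
  (N : Type) [AddCommGroup N] [Module F N] [Module A N] [IsScalarTower F A N]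

instance bc_smulComm : SMulCommClass (K ⊗[F] A) (K ⊗[F] Module.End A N) (BC F K N) where
  smul_comm x y z := by
    induction x with
    | zero => rw [zero_smul, zero_smul, smul_zero]
    | add a b ha hb => rw [add_smul, add_smul, smul_add, ha, hb]
    | tmul k a =>
      induction y with
      | zero =>
        refine (congrArg _ (zero_smul (K ⊗[F] Module.End A N) z)).trans ?_
        rw [smul_zero]
        exact (zero_smul (K ⊗[F] Module.End A N) ((k ⊗ₜ[F] a : K ⊗[F] A) • z)).symm
      | add a b ha hb => rw [add_smul, add_smul, smul_add, ha, hb]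
      | tmul l b =>
        induction z using BC.induction with
        | h0 => rw [smul_zero, smul_zero, smul_zero]
        | ha x y hx hy => rw [smul_add, smul_add, smul_add, smul_add, hx, hy]
        | ht m n =>
          rw [bc_smul, bc_smul, bc_smul, bc_smul, smul_comm, mul_left_comm]

theorem bc_full [Module.Finite A N] (φ : BC F K N →ₗ[K ⊗[F] A] BC F K N) :
    ∃ b : K ⊗[F] Module.End A N, ∀ n, φ n = b • n := by
  classical
  have : SMulCommClass F A N := IsScalarTower.to_smulCommClass
  let ℬ := Module.Basis.ofVectorSpace F K
  let ε := TensorProduct.equivFinsuppOfBasisLeft (N := N) ℬ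
  let E : BC F K N →+ (Module.Basis.ofVectorSpaceIndex F K →₀ N) := ε.toLinearMap.toAddMonoidHom
  have hE1 : ∀ m n i, E (bt F K m n) i = ℬ.repr m i • n := fun m n i =>
    TensorProduct.equivFinsuppOfBasisLeft_apply_tmul_apply ℬ m n i
  have hE2 : ∀ x, x = (E x).sum fun i n => bt F K (ℬ i) n := fun x =>
    (ε.symm_apply_apply x).symm.trans (TensorProduct.equivFinsuppOfBasisLeft_symm_apply ℬ (E x))
  have hEA : ∀ (a : A) x i, E ((1 ⊗ₜ[F] a : K ⊗[F] A) • x) i = a • E x i := by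
    intro a x i
    induction x using BC.induction with
    | h0 => rw [smul_zero, map_zero, Finsupp.zero_apply, smul_zero]
    | ha x y hx hy => rw [smul_add, map_add, map_add, Finsupp.add_apply, Finsupp.add_apply, hx, hy,
        smul_add]
    | ht m n => rw [bc_smul, hE1, hE1, one_mul, smul_comm]
  let ψ : Module.Basis.ofVectorSpaceIndex F K → Module.End A N := fun i =>
    { toFun := fun n => E (φ (bt F K 1 n)) i
      map_add' := fun x y => by rw [bt_add, map_add, map_add, Finsupp.add_apply]
      map_smul' := fun a x => by
        have h : bt F K (1 : K) (a • x) = (1 ⊗ₜ[F] a : K ⊗[F] A) • bt F K 1 x := by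
          rw [bc_smul, one_mul]
        rw [h, map_smul, hEA, RingHom.id_apply] }
  have hψ : ∀ i n, ψ i n = E (φ (bt F K 1 n)) i := fun _ _ => rfl
  obtain ⟨s, hs⟩ := (Module.Finite.fg_top : (⊤ : Submodule A N).FG)
  let I := s.biUnion fun n => (E (φ (bt F K 1 n))).support
  have hI : ∀ i, i ∉ I → ψ i = 0 := by
    intro i hi
    have : (⊤ : Submodule A N) ≤ LinearMap.ker (ψ i) := by
      rw [← hs, Submodule.span_le]
      intro n hn
      change ψ i n = 0
      rw [hψ]
      by_contra hne
      exact hi (Finset.mem_biUnion.mpr ⟨n, hn, Finsupp.mem_support_iff.mpr hne⟩)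
    ext n
    exact this (Submodule.mem_top (x := n))
  have h1 : ∀ n, φ (bt F K 1 n) = ∑ i ∈ I, bt F K (ℬ i) (ψ i n) := by
    intro n
    refine (hE2 _).trans ?_
    refine Finsupp.sum_of_support_subset _ ?_ _ (fun i _ => bt_zero F K _)
    intro i hi
    by_contra hne
    have := hI i hne
    apply Finsupp.mem_support_iff.mp hi
    rw [← hψ, this]; rfl
  refine ⟨∑ i ∈ I, ℬ i ⊗ₜ ψ i, fun x => ?_⟩
  induction x using BC.induction with
  | h0 => rw [smul_zero, map_zero]
  | ha x y hx hy => rw [smul_add, map_add, hx, hy]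
  | ht k n =>
    have h : bt F K k n = (k ⊗ₜ[F] 1 : K ⊗[F] A) • bt F K 1 n := by
      rw [bc_smul, mul_one, one_smul]
    rw [Finset.sum_smul]
    conv_lhs => rw [h, map_smul, h1, Finset.smul_sum]
    refine Finset.sum_congr rfl fun i _ => ?_
    rw [bc_smul, bc_smul, one_smul, mul_comm]
    rfl

theorem bc_main [FiniteDimensional F A] [Module.Finite A N]
    (hC1 : IsC1Field F) (hpc : PerfectlyClosedIn F K)
    (hN : ∀ (X : Type) [AddCommGroup X] [Module A X], Module.Finite A X → InAdd A N X) :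
    FiniteRepType (K ⊗[F] A) := by
  have : Module.Finite F N := Module.Finite.trans A N
  have : IsArtinianRing (Module.End A N) := IsArtinianRing.of_finite F (Module.End A N)
  have : IsArtinianRing (K ⊗[F] A) := IsArtinianRing.of_finite K (K ⊗[F] A)
  have : IsArtinianRing (K ⊗[F] Module.End A N) :=
    IsArtinianRing.of_finite K (K ⊗[F] Module.End A N)
  have hss : IsSemisimpleRing (K ⊗[F] (Module.End A N ⧸ Ring.jacobson (Module.End A N))) :=
    semisimple_baseChange hC1 hpc
  have hself := inAdd_self (hN A inferInstance)
  have : Module.Projective (K ⊗[F] Module.End A N) (BC F K N) :=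
    bc_inAdd_projective F K (Module.End A N) hself
  have : Module.Finite (K ⊗[F] Module.End A N) (BC F K N) :=
    bc_inAdd_finite F K (Module.End A N) hself
  have : Module.Finite (K ⊗[F] A) (BC F K N) := by
    obtain ⟨n, p, hp⟩ := Module.Finite.exists_fin' A N
    have := bc_inAdd_finite F K A (InAdd.pi (R := A) (Q := A) (Fin n))
    exact Module.Finite.of_surjective _ (bcMap_surjective F K A p hp)
  refine finiteRepType_of_inAdd (BC F K N) fun X _ _ hX => ?_
  refine recover (bc_full F K A N) ?_ X (hom_proj (Γ := K ⊗[F] Module.End A N) ?_ X)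
  · intro X _ _ _ x hx
    obtain ⟨f, hf⟩ := exists_to_dual F A K X x hx
    have : Module.Finite A (DualAlg F A) := Module.Finite.of_restrictScalars_finite F A _
    obtain ⟨ι, _, α, β, h⟩ := InAdd.bc F K A (hN (DualAlg F A) inferInstance)
    by_contra! hcon
    apply hf
    have h1 := LinearMap.congr_fun h (f x)
    rw [LinearMap.id_apply, LinearMap.sum_apply] at h1
    rw [← h1]
    refine Finset.sum_eq_zero fun l _ => ?_
    have h2 : β l (f x) = 0 := hcon (β l ∘ₗ f)
    rw [LinearMap.comp_apply, h2, map_zero]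
  · intro Z _ _ hZ
    exact bc_glDim F K (Module.End A N) (inAdd_ker hN) hss Z hZ
end Final

/-- **Corollary 4.2.** Let `F` be a `C₁`-field, `A` a
finite-dimensional `F`-algebra of finite representation type, and `K/F` a field
extension in which `F` is perfectly closed.  Then `A_K = K ⊗_F A` is also of
finite representation type. -/
theorem finiteRepType_base_change
    (F K A : Type) [Field F] [Field K] [Algebra F K]
    [Ring A] [Algebra F A] [FiniteDimensional F A]
    (hC1 : IsC1Field F) (hfrt : FiniteRepType A) (hpc : PerfectlyClosedIn F K) :
    FiniteRepType (K ⊗[F] A) := by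
  have : IsArtinianRing A := IsArtinianRing.of_finite F A
  obtain ⟨N, hfin, hN⟩ := hfrt.exists_inAdd
  let _ : Module F N := Module.compHom N (algebraMap F A)
  have : IsScalarTower F A N := ⟨fun c a n => by
    rw [Algebra.smul_def, mul_smul]; rfl⟩
  exact bc_main F K A N hC1 hpc hN
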